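/- arXiv:1409.6447 — 3 statements merged into one kernel-verified Lean document; each statement's English description precedes it below -/
import Mathlib

section
/- Consider the one-way random-effect probit model with two-piece normal random effects, and suppose there exist constants m̄, M̄ > 0 such that h(γ) ≤ m̄ and H(γ) ≥ M̄ for all γ ∈ Γ. Suppose (i) there is r_1 with 2 ≤ r_1 ≤ r such that for each i = 1,…,r_1 the i-th group contains at least one success (some y_{ik} = 1) and at least one failure (some y_{ik} = 0); (ii) −(r_1−1)/2 < a_1 < 0; and (iii) ∫_Γ H(γ)^{2a_1} π(γ) dγ < ∞. Then the marginal likelihood m(y) is finite, i.e. the posterior distribution of (μ, σ, γ) is proper. -/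
open MeasureTheory Real Set
open scoped ENNReal

noncomputable def stdNormalPDF (x : ℝ) : ℝ :=
  (Real.sqrt (2 * Real.pi))⁻¹ * Real.exp (-(x ^ 2) / 2)

noncomputable def stdNormalCDF (x : ℝ) : ℝ :=
  ∫ t in Set.Iic x, stdNormalPDF t

noncomputable def tpnPDF (aF bF : ℝ → ℝ) (σ γ u : ℝ) : ℝ :=
  (2 / (σ * (aF γ + bF γ))) *
    (if u < 0 then stdNormalPDF (u / (σ * bF γ)) else stdNormalPDF (u / (σ * aF γ)))

/-- Marginal likelihood of the one-way random-effect probit model with two-piece normal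
random effects.  `yobs i k ∈ {0, 1}` is the `k`-th binary observation in group `i`. -/
noncomputable def probitTPNMarginal {r : ℕ} {qs : Fin r → ℕ}
    (yobs : (i : Fin r) → Fin (qs i) → ℕ)
    (aF bF : ℝ → ℝ) (Γset : Set ℝ) (πγ : ℝ → ℝ) (a1 : ℝ) : ℝ≥0∞ :=
  ∫⁻ γ in Γset,
    ∫⁻ σ in Set.Ioi (0 : ℝ),
      ∫⁻ μ : ℝ,
        ∫⁻ u : Fin r → ℝ,
          ENNReal.ofReal (
            (∏ i, ∏ k, (stdNormalCDF (μ + u i)) ^ (yobs i k) *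
              (1 - stdNormalCDF (μ + u i)) ^ (1 - yobs i k)) *
            (∏ i, tpnPDF aF bF σ γ (u i)) *
            σ ^ (-(2 * a1 + 1)) * πγ γ)

open ProbabilityTheory in
lemma aux_pdf_eq (m c : ℝ) (hc : 0 < c) (u : ℝ) :
    stdNormalPDF ((u - m) / c) = c * gaussianPDFReal m ((c ^ 2).toNNReal) u := by
  have h : ((c ^ 2).toNNReal : ℝ) = c ^ 2 := Real.coe_toNNReal _ (by positivity)
  rw [stdNormalPDF, gaussianPDFReal, h, Real.sqrt_mul (by positivity) (c ^ 2), Real.sqrt_sq hc.le]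
  have : -((u - m) / c) ^ 2 / 2 = -(u - m) ^ 2 / (2 * c ^ 2) := by field_simp
  rw [this]
  have h2 : 0 < √(2 * π) := by positivity
  field_simp

lemma aux_sq_ne (c : ℝ) (hc : 0 < c) : (c ^ 2).toNNReal ≠ 0 := by
  simpa using hc.ne'

open ProbabilityTheory in
lemma aux_pdf_lintegral (c : ℝ) (hc : 0 < c) :
    ∫⁻ u, ENNReal.ofReal (stdNormalPDF (u / c)) = ENNReal.ofReal c := by
  have h : ∀ u, ENNReal.ofReal (stdNormalPDF (u / c))
      = ENNReal.ofReal c * gaussianPDF 0 ((c ^ 2).toNNReal) u := by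
    intro u
    have := aux_pdf_eq 0 c hc u
    rw [sub_zero] at this
    rw [this, ENNReal.ofReal_mul hc.le, gaussianPDF]
  simp_rw [h]
  rw [lintegral_const_mul' _ _ ENNReal.ofReal_ne_top,
    lintegral_gaussianPDF_eq_one _ (aux_sq_ne c hc), mul_one]

open ProbabilityTheory in
lemma aux_pdf_shift (m : ℝ) :
    Integrable (fun u => stdNormalPDF (u - m)) ∧ ∫ u, stdNormalPDF (u - m) = 1 := by
  have h : (fun u => stdNormalPDF (u - m)) = gaussianPDFReal m (((1 : ℝ) ^ 2).toNNReal) := by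
    ext u
    have := aux_pdf_eq m 1 one_pos u
    simpa using this
  rw [h]
  exact ⟨integrable_gaussianPDFReal _ _, integral_gaussianPDFReal_eq_one _ (aux_sq_ne 1 one_pos)⟩

lemma aux_pdf_nonneg (x : ℝ) : 0 ≤ stdNormalPDF x := by
  unfold stdNormalPDF; positivity

lemma aux_pdf_le_one (x : ℝ) : stdNormalPDF x ≤ 1 := by
  unfold stdNormalPDF
  have h1 : (√(2 * π))⁻¹ ≤ 1 := by
    apply inv_le_one_of_one_le₀
    rw [Real.one_le_sqrt]
    nlinarith [Real.pi_gt_three]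
  have h2 : Real.exp (-(x ^ 2) / 2) ≤ 1 := by
    rw [Real.exp_le_one_iff]; nlinarith [sq_nonneg x]
  exact mul_le_one₀ h1 (by positivity) h2

lemma aux_pdf_integrable : Integrable stdNormalPDF := by
  simpa using (aux_pdf_shift 0).1

lemma aux_pdf_integral : ∫ u, stdNormalPDF u = 1 := by
  simpa using (aux_pdf_shift 0).2

lemma aux_cdf_nonneg (x : ℝ) : 0 ≤ stdNormalCDF x :=
  integral_nonneg fun t => aux_pdf_nonneg t

lemma aux_cdf_compl (x : ℝ) : 1 - stdNormalCDF x = ∫ t in Set.Ioi x, stdNormalPDF t := by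
  have h := integral_add_compl (measurableSet_Iic (a := x)) aux_pdf_integrable
  rw [aux_pdf_integral, Set.compl_Iic] at h
  unfold stdNormalCDF
  linarith

lemma aux_cdf_le_one (x : ℝ) : stdNormalCDF x ≤ 1 := by
  have h : 0 ≤ 1 - stdNormalCDF x := by
    rw [aux_cdf_compl]
    exact integral_nonneg fun t => aux_pdf_nonneg t
  linarith

lemma aux_tilt (s : ℝ) (hs : s ^ 2 = 1) (t : ℝ) :
    stdNormalPDF t * Real.exp (s * t) = Real.exp (1 / 2) * stdNormalPDF (t - s) := by
  unfold stdNormalPDF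
  have : Real.exp (-(t ^ 2) / 2) * Real.exp (s * t)
      = Real.exp (1 / 2) * Real.exp (-((t - s) ^ 2) / 2) := by
    rw [← Real.exp_add, ← Real.exp_add]
    congr 1
    linear_combination (1 / 2 : ℝ) * hs
  linear_combination (√(2 * π))⁻¹ * this

lemma aux_exp_half : Real.exp (1 / 2) ≤ 2 := by
  have h : Real.exp (1 / 2) ^ 2 = Real.exp 1 := by
    rw [← Real.exp_nat_mul]; norm_num
  have := Real.exp_one_lt_d9
  nlinarith [Real.exp_pos (1 / 2)]

/-- Chernoff bound on a set where `s * (t - x) ≥ 0`. -/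
lemma aux_chernoff (s : ℝ) (hs : s ^ 2 = 1) (x : ℝ) (S : Set ℝ) (hS : MeasurableSet S)
    (h : ∀ t ∈ S, 0 ≤ s * (t - x)) :
    ∫ t in S, stdNormalPDF t ≤ 2 * Real.exp (-(s * x)) := by
  have hi : Integrable (fun t => Real.exp (-(s * x)) * (Real.exp (1 / 2) * stdNormalPDF (t - s))) :=
    ((aux_pdf_shift s).1.const_mul _).const_mul _
  calc ∫ t in S, stdNormalPDF t
      ≤ ∫ t in S, Real.exp (-(s * x)) * (Real.exp (1 / 2) * stdNormalPDF (t - s)) := by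
        refine setIntegral_mono_on aux_pdf_integrable.integrableOn hi.integrableOn hS ?_
        intro t ht
        rw [← aux_tilt s hs t]
        have h1 : 1 ≤ Real.exp (s * (t - x)) := Real.one_le_exp (h t ht)
        have h2 : Real.exp (s * (t - x)) = Real.exp (s * t) * Real.exp (-(s * x)) := by
          rw [← Real.exp_add]; congr 1; ring
        have h3 := mul_le_mul_of_nonneg_left h1 (aux_pdf_nonneg t)
        rw [h2] at h3
        linarith
    _ ≤ ∫ t, Real.exp (-(s * x)) * (Real.exp (1 / 2) * stdNormalPDF (t - s)) := by
        refine setIntegral_le_integral hi (ae_of_all _ fun t => ?_)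
        have := aux_pdf_nonneg (t - s)
        simp only [Pi.zero_apply]
        positivity
    _ = Real.exp (-(s * x)) * Real.exp (1 / 2) := by
        rw [integral_const_mul, integral_const_mul, (aux_pdf_shift s).2, mul_one]
    _ ≤ _ := by
        have := aux_exp_half
        have := Real.exp_pos (-(s * x))
        nlinarith

lemma aux_exp_neg_le (y : ℝ) (hy : 0 ≤ y) : 2 * Real.exp (-y) ≤ 4 * (1 + y ^ 2)⁻¹ := by
  have h := Real.quadratic_le_exp_of_nonneg hy
  rw [Real.exp_neg]
  have h1 : (Real.exp y)⁻¹ ≤ ((1 + y ^ 2) / 2)⁻¹ := by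
    apply inv_anti₀ (by positivity)
    linarith
  rw [inv_div] at h1
  calc _ ≤ 2 * (2 / (1 + y ^ 2)) := by linarith
    _ = _ := by ring

lemma aux_min_bound (x L : ℝ) (h1 : L ≤ stdNormalCDF x) (h2 : L ≤ 1 - stdNormalCDF x) :
    L ≤ 4 * (1 + x ^ 2)⁻¹ := by
  rcases le_total 0 x with hx | hx
  · rw [aux_cdf_compl] at h2
    have := aux_chernoff 1 (by norm_num) x (Set.Ioi x) measurableSet_Ioi
      (fun t ht => by have : x < t := ht; linarith)
    have h3 := aux_exp_neg_le x hx
    rw [one_mul] at this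
    linarith
  · have := aux_chernoff (-1) (by norm_num) x (Set.Iic x) measurableSet_Iic
      (fun t ht => by have : t ≤ x := ht; linarith)
    have h3 := aux_exp_neg_le (-x) (by linarith)
    rw [neg_one_mul] at this
    rw [neg_sq] at h3
    unfold stdNormalCDF at h1
    linarith

/-- Bound for the contribution of a group. -/
lemma aux_group {q : ℕ} (y : Fin q → ℕ) (hy : ∀ k, y k = 0 ∨ y k = 1) (x : ℝ) :
    0 ≤ ∏ k, (stdNormalCDF x) ^ (y k) * (1 - stdNormalCDF x) ^ (1 - y k) ∧
    ∏ k, (stdNormalCDF x) ^ (y k) * (1 - stdNormalCDF x) ^ (1 - y k) ≤ 1 ∧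
    ((∃ k, y k = 1) ∧ (∃ k, y k = 0) →
      ∏ k, (stdNormalCDF x) ^ (y k) * (1 - stdNormalCDF x) ^ (1 - y k) ≤ 4 * (1 + x ^ 2)⁻¹) := by
  have p0 := aux_cdf_nonneg x
  have p1 := aux_cdf_le_one x
  set f : Fin q → ℝ := fun k => (stdNormalCDF x) ^ (y k) * (1 - stdNormalCDF x) ^ (1 - y k) with hf
  have f0 : ∀ k, 0 ≤ f k := by
    intro k
    have : 0 ≤ 1 - stdNormalCDF x := by linarith
    simp only [hf]; positivity
  have f1 : ∀ k, f k ≤ 1 := by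
    intro k
    rcases hy k with h | h <;> simp [hf, h] <;> linarith
  have hsingle : ∀ k, ∏ j, f j ≤ f k := by
    intro k
    rw [← Finset.mul_prod_erase Finset.univ f (Finset.mem_univ k)]
    exact mul_le_of_le_one_right (f0 k)
      (Finset.prod_le_one (fun i _ => f0 i) (fun i _ => f1 i))
  refine ⟨Finset.prod_nonneg fun i _ => f0 i,
    Finset.prod_le_one (fun i _ => f0 i) (fun i _ => f1 i), ?_⟩
  rintro ⟨⟨k, hk⟩, ⟨l, hl⟩⟩
  apply aux_min_bound
  · simpa [hf, hk] using hsingle k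
  · simpa [hf, hl] using hsingle l

lemma aux_lintegral_pi {n : ℕ} (f : Fin n → ℝ → ℝ≥0∞) (hf : ∀ i, Measurable (f i)) :
    ∫⁻ u : Fin n → ℝ, ∏ i, f i (u i) = ∏ i, ∫⁻ t, f i t := by
  induction n with
  | zero => simp [volume_pi]
  | succ n ih =>
    have hm := (volume_preserving_piFinSuccAbove (fun _ : Fin (n + 1) => ℝ) 0).symm
    rw [← hm.lintegral_comp_emb (MeasurableEquiv.measurableEmbedding _), Measure.volume_eq_prod,
      lintegral_prod _ (by fun_prop), Fin.prod_univ_succ, ← ih _ (fun i => hf i.succ),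
      ← lintegral_mul_const _ (hf 0)]
    refine lintegral_congr fun t => ?_
    rw [← lintegral_const_mul _ (by fun_prop)]
    refine lintegral_congr fun v => ?_
    simp [Fin.prod_univ_succ, MeasurableEquiv.piFinSuccAbove_symm_apply]

/-- The scale integral. -/
lemma aux_scale (p : ℝ) (n : ℕ) (hp : 0 < p) (hpn : p < n) :
    ∃ J : ℝ, ∀ H : ℝ, 0 < H →
      ∫⁻ σ in Set.Ioi (0 : ℝ), ENNReal.ofReal (σ ^ (p - 1) * (min 1 (σ * H)⁻¹) ^ n)
        ≤ ENNReal.ofReal (J * H ^ (-p)) := by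
  set W : ℝ → ℝ := fun τ => τ ^ (p - 1) * (min 1 τ⁻¹) ^ n with hW
  have hWm : Measurable W := by simp only [hW]; fun_prop
  have hWi : IntegrableOn W (Set.Ioi 0) := by
    rw [← Set.Ioo_union_Ici_eq_Ioi (zero_lt_one (α := ℝ)), integrableOn_union,
      integrableOn_Ici_iff_integrableOn_Ioi]
    constructor
    · have h := (intervalIntegral.integrableOn_Ioo_rpow_iff (s := p - 1) one_pos).2 (by linarith)
      refine Integrable.mono' h hWm.aestronglyMeasurable ?_
      filter_upwards [ae_restrict_mem measurableSet_Ioo] with t ht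
      have h0 : 0 < t := ht.1
      have h1 : 0 ≤ min 1 t⁻¹ := by positivity
      rw [Real.norm_of_nonneg (by positivity)]
      exact mul_le_of_le_one_right (by positivity) (pow_le_one₀ h1 (min_le_left _ _))
    · have h := integrableOn_Ioi_rpow_of_lt (a := p - 1 - n) (by linarith) (zero_lt_one (α := ℝ))
      refine Integrable.mono' h hWm.aestronglyMeasurable ?_
      filter_upwards [ae_restrict_mem measurableSet_Ioi] with t ht
      have h0 : 0 < t := lt_trans one_pos ht
      have h1 : 0 ≤ min 1 t⁻¹ := by positivity
      rw [Real.norm_of_nonneg (by positivity), Real.rpow_sub h0 (p - 1), Real.rpow_natCast,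
        div_eq_mul_inv, ← inv_pow]
      simp only [hW]
      gcongr
      exact min_le_right _ _
  refine ⟨∫ τ in Set.Ioi 0, W τ, fun H hH => ?_⟩
  have hWH : IntegrableOn (fun σ => W (H * σ)) (Set.Ioi 0) := by
    rw [integrableOn_Ioi_comp_mul_left_iff W 0 hH, mul_zero]; exact hWi
  have hnn : ∀ t, 0 < t → 0 ≤ W t := by
    intro t ht
    have h1 : 0 ≤ min 1 t⁻¹ := by positivity
    simp only [hW]; positivity
  have heq : ∀ σ ∈ Set.Ioi (0 : ℝ),
      ENNReal.ofReal (σ ^ (p - 1) * (min 1 (σ * H)⁻¹) ^ n)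
        = ENNReal.ofReal (H ^ (1 - p) * W (H * σ)) := by
    intro σ hσ
    have h0 : 0 < σ := hσ
    simp only [hW]
    rw [Real.mul_rpow hH.le h0.le, mul_comm σ H, ← mul_assoc, ← mul_assoc, ← Real.rpow_add hH]
    simp
  rw [setLIntegral_congr_fun measurableSet_Ioi heq,
    ← ofReal_integral_eq_lintegral_ofReal (hWH.const_mul _), integral_const_mul,
    integral_comp_mul_left_Ioi W 0 hH, mul_zero, smul_eq_mul]
  · apply le_of_eq
    congr 1
    have : H ^ (-p) = H ^ (1 - p) * H⁻¹ := by
      rw [← Real.rpow_neg_one H, ← Real.rpow_add hH]; congr 1; ring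
    rw [this]; ring
  · filter_upwards [ae_restrict_mem measurableSet_Ioi] with t ht
    have := hnn (H * t) (mul_pos hH ht)
    simp only [Pi.zero_apply]
    positivity

/-- Integrable envelope of the likelihood of a group with a success and a failure. -/
noncomputable def auxG (x : ℝ) : ℝ≥0∞ := ENNReal.ofReal (4 * (1 + x ^ 2)⁻¹)

lemma auxG_meas : Measurable auxG := by unfold auxG; fun_prop

lemma auxG_le (x : ℝ) : auxG x ≤ 4 := by
  have : 4 * (1 + x ^ 2)⁻¹ ≤ 4 := by
    have : (1 + x ^ 2)⁻¹ ≤ 1 := inv_le_one_of_one_le₀ (by nlinarith [sq_nonneg x])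
    linarith
  calc auxG x ≤ ENNReal.ofReal 4 := ENNReal.ofReal_le_ofReal this
    _ = 4 := by simp

lemma auxG_int : ∫⁻ x, auxG x < ⊤ :=
  (integrable_inv_one_add_sq.const_mul 4).lintegral_lt_top

lemma aux_S (aF bF : ℝ → ℝ) (σ γ : ℝ) (hσ : 0 < σ) (ha : 0 < aF γ) (hb : 0 < bF γ) :
    Measurable (fun u => ENNReal.ofReal (tpnPDF aF bF σ γ u)) ∧
    (∀ u, ENNReal.ofReal (tpnPDF aF bF σ γ u)
      ≤ 2 * ENNReal.ofReal ((σ * (aF γ + bF γ))⁻¹)) ∧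
    ∫⁻ u, ENNReal.ofReal (tpnPDF aF bF σ γ u) ≤ 2 ∧ ∀ u, 0 ≤ tpnPDF aF bF σ γ u := by
  have hH : 0 < σ * (aF γ + bF γ) := by positivity
  have hpm : Measurable stdNormalPDF := by unfold stdNormalPDF; fun_prop
  refine ⟨?_, ?_, ?_, ?_⟩
  · apply Measurable.ennreal_ofReal
    unfold tpnPDF
    apply Measurable.const_mul
    exact Measurable.ite measurableSet_Iio (by fun_prop) (by fun_prop)
  · intro u
    have h2 : (2 : ℝ≥0∞) = ENNReal.ofReal 2 := by simp
    rw [h2, ← ENNReal.ofReal_mul (by norm_num)]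
    apply ENNReal.ofReal_le_ofReal
    unfold tpnPDF
    rw [div_eq_mul_inv]
    apply mul_le_of_le_one_right (by positivity)
    split_ifs <;> exact aux_pdf_le_one _
  · have hle : ∀ u, ENNReal.ofReal (tpnPDF aF bF σ γ u) ≤
        ENNReal.ofReal (2 / (σ * (aF γ + bF γ))) *
          (ENNReal.ofReal (stdNormalPDF (u / (σ * bF γ)))
            + ENNReal.ofReal (stdNormalPDF (u / (σ * aF γ)))) := by
      intro u
      unfold tpnPDF
      rw [ENNReal.ofReal_mul (by positivity)]
      gcongr
      split_ifs
      · exact le_self_add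
      · exact le_add_self
    refine (lintegral_mono hle).trans ?_
    rw [lintegral_const_mul' _ _ ENNReal.ofReal_ne_top, lintegral_add_left (by fun_prop),
      aux_pdf_lintegral _ (by positivity), aux_pdf_lintegral _ (by positivity),
      ← ENNReal.ofReal_add (by positivity) (by positivity), ← ENNReal.ofReal_mul (by positivity)]
    have : 2 / (σ * (aF γ + bF γ)) * (σ * bF γ + σ * aF γ) = 2 := by
      field_simp
      ring
    rw [this]; simp
  · intro u
    unfold tpnPDF
    have : 0 ≤ 2 / (σ * (aF γ + bF γ)) := by positivity
    apply mul_nonneg this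
    split_ifs <;> exact aux_pdf_nonneg _

lemma aux_inner {r : ℕ} (r1 : ℕ) (hr1 : 2 ≤ r1) (hr1r : r1 ≤ r) (S : ℝ → ℝ≥0∞)
    (hS : Measurable S) (t : ℝ) (hSt : ∀ u, S u ≤ 2 * ENNReal.ofReal t) (hS2 : ∫⁻ u, S u ≤ 2) :
    ∫⁻ μ : ℝ, ∏ i : Fin r, ∫⁻ u, (if (i : ℕ) < r1 then auxG (μ + u) else 1) * S u
      ≤ (8 + 2 * ∫⁻ x, auxG x) ^ r * ENNReal.ofReal (min 1 t) ^ (r1 - 1) := by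
  set D : ℝ≥0∞ := 8 + 2 * ∫⁻ x, auxG x with hD
  set M : ℝ≥0∞ := ENNReal.ofReal (min 1 t) with hM
  have hD8 : 8 ≤ D := le_self_add
  have hDI : 2 * ∫⁻ x, auxG x ≤ D := le_add_self
  have hGm := auxG_meas
  -- pointwise bound
  have hF : ∀ μ, ∫⁻ u, auxG (μ + u) * S u ≤ D * M := by
    intro μ
    rcases min_choice 1 t with h | h
    · rw [hM, h, ENNReal.ofReal_one, mul_one]
      calc ∫⁻ u, auxG (μ + u) * S u ≤ ∫⁻ u, 4 * S u :=
            lintegral_mono fun u => by gcongr; exact auxG_le _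
        _ = 4 * ∫⁻ u, S u := lintegral_const_mul _ hS
        _ ≤ 4 * 2 := by gcongr
        _ = 8 := by norm_num
        _ ≤ D := hD8
    · rw [hM, h]
      calc ∫⁻ u, auxG (μ + u) * S u ≤ ∫⁻ u, (2 * ENNReal.ofReal t) * auxG (μ + u) :=
            lintegral_mono fun u => by
              rw [mul_comm]; gcongr; exact hSt u
        _ = (2 * ENNReal.ofReal t) * ∫⁻ u, auxG (μ + u) :=
            lintegral_const_mul _ (by fun_prop)
        _ = (2 * ENNReal.ofReal t) * ∫⁻ u, auxG u := by
            rw [lintegral_add_left_eq_self]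
        _ = (2 * ∫⁻ u, auxG u) * ENNReal.ofReal t := by ring
        _ ≤ D * ENNReal.ofReal t := by gcongr
  have hF0 : ∫⁻ μ, ∫⁻ u, auxG (μ + u) * S u ≤ D := by
    rw [lintegral_lintegral_swap (by
      apply Measurable.aemeasurable
      unfold Function.uncurry
      fun_prop)]
    calc ∫⁻ u, ∫⁻ μ, auxG (μ + u) * S u = ∫⁻ u, (∫⁻ x, auxG x) * S u := by
          refine lintegral_congr fun u => ?_
          rw [lintegral_mul_const _ (by fun_prop), lintegral_add_right_eq_self]
      _ = (∫⁻ x, auxG x) * ∫⁻ u, S u := lintegral_const_mul _ hS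
      _ ≤ (∫⁻ x, auxG x) * 2 := by gcongr
      _ = 2 * ∫⁻ x, auxG x := mul_comm _ _
      _ ≤ D := hDI
  have hr0 : 0 < r := by omega
  set i0 : Fin r := ⟨0, hr0⟩ with hi0
  have hcard : ((Finset.univ.erase i0).filter (fun i : Fin r => (i : ℕ) < r1)).card = r1 - 1 := by
    rw [Finset.filter_erase, Finset.card_erase_of_mem, Fin.card_filter_val_lt]
    · congr 1; omega
    · simp [hi0]; omega
  have hprod : ∀ μ, ∏ i : Fin r, ∫⁻ u, (if (i : ℕ) < r1 then auxG (μ + u) else 1) * S u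
      ≤ (D ^ (r - 1) * M ^ (r1 - 1)) * ∫⁻ u, auxG (μ + u) * S u := by
    intro μ
    rw [← Finset.mul_prod_erase Finset.univ _ (Finset.mem_univ i0), mul_comm]
    have h0 : (i0 : ℕ) < r1 := by simp [hi0]; omega
    simp only [h0, if_true]
    gcongr
    calc ∏ i ∈ Finset.univ.erase i0, ∫⁻ u, (if (i : ℕ) < r1 then auxG (μ + u) else 1) * S u
        ≤ ∏ i ∈ Finset.univ.erase i0, (D * if (i : ℕ) < r1 then M else 1) := by
          refine Finset.prod_le_prod' fun i _ => ?_
          split_ifs with h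
          · exact hF μ
          · simp only [one_mul, mul_one]
            exact hS2.trans (le_trans (by norm_num) hD8)
      _ = D ^ (r - 1) * M ^ (r1 - 1) := by
          rw [Finset.prod_mul_distrib, Finset.prod_const, Finset.card_erase_of_mem
            (Finset.mem_univ i0), Finset.card_univ, Fintype.card_fin, Finset.prod_ite,
            Finset.prod_const, Finset.prod_const_one, mul_one, hcard]
  calc _ ≤ ∫⁻ μ, (D ^ (r - 1) * M ^ (r1 - 1)) * ∫⁻ u, auxG (μ + u) * S u := lintegral_mono hprod
    _ = (D ^ (r - 1) * M ^ (r1 - 1)) * ∫⁻ μ, ∫⁻ u, auxG (μ + u) * S u := by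
        apply lintegral_const_mul
        apply Measurable.lintegral_prod_right
        fun_prop
    _ ≤ (D ^ (r - 1) * M ^ (r1 - 1)) * D := by gcongr
    _ = D ^ (r - 1 + 1) * M ^ (r1 - 1) := by ring
    _ = D ^ r * M ^ (r1 - 1) := by rw [Nat.sub_add_cancel hr0]

/-- Propriety of the posterior of the one-way random-effect probit model
with two-piece normal random effects. -/
theorem probit_tpn_posterior_proper
    {r : ℕ} {qs : Fin r → ℕ}
    (yobs : (i : Fin r) → Fin (qs i) → ℕ)
    (aF bF : ℝ → ℝ) (Γset : Set ℝ) (πγ : ℝ → ℝ) (a1 : ℝ)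
    (hbin : ∀ i k, yobs i k = 0 ∨ yobs i k = 1)
    (hΓmeas : MeasurableSet Γset)
    (habmeas : Measurable aF ∧ Measurable bF)
    (hab : ∀ γ ∈ Γset, 0 < aF γ ∧ 0 < bF γ)
    (hπmeas : Measurable πγ)
    (hπnonneg : ∀ γ ∈ Γset, 0 ≤ πγ γ)
    (hπproper : ∫ γ in Γset, πγ γ = 1)
    -- bounds on h(γ) = min{a(γ),b(γ)} and H(γ) = a(γ)+b(γ)
    (mbar Mbar : ℝ) (hmbar : 0 < mbar) (hMbar : 0 < Mbar)
    (hhm : ∀ γ ∈ Γset, min (aF γ) (bF γ) ≤ mbar)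
    (hHM : ∀ γ ∈ Γset, Mbar ≤ aF γ + bF γ)
    -- condition (i): groups 1,…,r₁ each contain at least one success and one failure
    (r1 : ℕ) (hr1 : 2 ≤ r1) (hr1r : r1 ≤ r)
    (hsf : ∀ i : Fin r, (i : ℕ) < r1 →
      (∃ k, yobs i k = 1) ∧ (∃ k, yobs i k = 0))
    -- condition (ii): -(r₁ - 1)/2 < a₁ < 0
    (ha1 : -(((r1 : ℝ) - 1) / 2) < a1 ∧ a1 < 0)
    -- condition (iii)
    (hint : ∫⁻ γ in Γset, ENNReal.ofReal ((aF γ + bF γ) ^ (2 * a1) * πγ γ) < ⊤) :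
    probitTPNMarginal yobs aF bF Γset πγ a1 < ⊤ := by
  have hDtop : (8 + 2 * ∫⁻ x, auxG x) ^ r ≠ ⊤ :=
    ENNReal.pow_ne_top (ENNReal.add_ne_top.2
      ⟨by simp, ENNReal.mul_ne_top (by simp) auxG_int.ne⟩)
  set D : ℝ≥0∞ := (8 + 2 * ∫⁻ x, auxG x) ^ r with hD
  have hcast : ((r1 - 1 : ℕ) : ℝ) = (r1 : ℝ) - 1 := by
    rw [Nat.cast_sub (by omega)]; simp
  obtain ⟨J, hJ⟩ := aux_scale (-(2 * a1)) (r1 - 1) (by linarith [ha1.2])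
    (by rw [hcast]; linarith [ha1.1])
  have hmain : ∀ γ ∈ Γset,
      (∫⁻ σ in Set.Ioi (0 : ℝ), ∫⁻ μ : ℝ, ∫⁻ u : Fin r → ℝ,
          ENNReal.ofReal (
            (∏ i, ∏ k, (stdNormalCDF (μ + u i)) ^ (yobs i k) *
              (1 - stdNormalCDF (μ + u i)) ^ (1 - yobs i k)) *
            (∏ i, tpnPDF aF bF σ γ (u i)) *
            σ ^ (-(2 * a1 + 1)) * πγ γ))
        ≤ (D * ENNReal.ofReal J) * ENNReal.ofReal ((aF γ + bF γ) ^ (2 * a1) * πγ γ) := by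
    intro γ hγ
    obtain ⟨ha, hb⟩ := hab γ hγ
    have hπ := hπnonneg γ hγ
    have hH : 0 < aF γ + bF γ := by positivity
    have hσ : ∀ σ ∈ Set.Ioi (0 : ℝ),
        (∫⁻ μ : ℝ, ∫⁻ u : Fin r → ℝ,
          ENNReal.ofReal (
            (∏ i, ∏ k, (stdNormalCDF (μ + u i)) ^ (yobs i k) *
              (1 - stdNormalCDF (μ + u i)) ^ (1 - yobs i k)) *
            (∏ i, tpnPDF aF bF σ γ (u i)) *
            σ ^ (-(2 * a1 + 1)) * πγ γ))
        ≤ (ENNReal.ofReal (πγ γ) * D) * ENNReal.ofReal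
          (σ ^ (-(2 * a1) - 1) * (min 1 (σ * (aF γ + bF γ))⁻¹) ^ (r1 - 1)) := by
      intro σ hσ
      have hσ0 : 0 < σ := hσ
      obtain ⟨hSm, hSt, hS2, hS0⟩ := aux_S aF bF σ γ hσ0 ha hb
      have hGm := auxG_meas
      have hpt : ∀ μ : ℝ, ∀ u : Fin r → ℝ,
          ENNReal.ofReal (
            (∏ i, ∏ k, (stdNormalCDF (μ + u i)) ^ (yobs i k) *
              (1 - stdNormalCDF (μ + u i)) ^ (1 - yobs i k)) *
            (∏ i, tpnPDF aF bF σ γ (u i)) *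
            σ ^ (-(2 * a1 + 1)) * πγ γ)
          ≤ ENNReal.ofReal (σ ^ (-(2 * a1 + 1)) * πγ γ) *
            ∏ i : Fin r, ((if (i : ℕ) < r1 then auxG (μ + u i) else 1) *
              ENNReal.ofReal (tpnPDF aF bF σ γ (u i))) := by
        intro μ u
        rw [mul_assoc _ (σ ^ (-(2 * a1 + 1))), mul_comm,
          ENNReal.ofReal_mul (by positivity), ← Finset.prod_mul_distrib,
          ENNReal.ofReal_prod_of_nonneg
            (fun i _ => mul_nonneg (aux_group (yobs i) (hbin i) _).1 (hS0 _))]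
        gcongr with i _
        obtain ⟨g0, g1, g2⟩ := aux_group (yobs i) (hbin i) (μ + u i)
        rw [ENNReal.ofReal_mul g0]
        gcongr
        split_ifs with h
        · exact ENNReal.ofReal_le_ofReal (g2 (hsf i h))
        · exact ENNReal.ofReal_le_one.2 g1
      calc _ ≤ ∫⁻ μ : ℝ, ∫⁻ u : Fin r → ℝ,
            ENNReal.ofReal (σ ^ (-(2 * a1 + 1)) * πγ γ) *
            ∏ i : Fin r, ((if (i : ℕ) < r1 then auxG (μ + u i) else 1) *
              ENNReal.ofReal (tpnPDF aF bF σ γ (u i))) :=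
            lintegral_mono fun μ => lintegral_mono fun u => hpt μ u
        _ = ENNReal.ofReal (σ ^ (-(2 * a1 + 1)) * πγ γ) * ∫⁻ μ : ℝ,
            ∏ i : Fin r, ∫⁻ t, (if (i : ℕ) < r1 then auxG (μ + t) else 1) *
              ENNReal.ofReal (tpnPDF aF bF σ γ t) := by
            rw [← lintegral_const_mul' _ _ ENNReal.ofReal_ne_top]
            refine lintegral_congr fun μ => ?_
            rw [lintegral_const_mul' _ _ ENNReal.ofReal_ne_top]
            congr 1
            refine aux_lintegral_pi (fun (i : Fin r) t =>
              (if (i : ℕ) < r1 then auxG (μ + t) else 1) *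
              ENNReal.ofReal (tpnPDF aF bF σ γ t)) fun i => ?_
            refine Measurable.mul ?_ hSm
            split_ifs
            · fun_prop
            · fun_prop
        _ ≤ ENNReal.ofReal (σ ^ (-(2 * a1 + 1)) * πγ γ) *
            (D * ENNReal.ofReal (min 1 (σ * (aF γ + bF γ))⁻¹) ^ (r1 - 1)) := by
            gcongr
            exact aux_inner r1 hr1 hr1r _ hSm _ hSt hS2
        _ = _ := by
            have hmin : 0 ≤ min 1 (σ * (aF γ + bF γ))⁻¹ := by positivity
            have he : -(2 * a1 + 1) = -(2 * a1) - 1 := by ring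
            rw [ENNReal.ofReal_mul (by positivity), ENNReal.ofReal_mul (by positivity),
              ENNReal.ofReal_pow hmin, he]
            ring
    calc _ ≤ ∫⁻ σ in Set.Ioi (0 : ℝ), (ENNReal.ofReal (πγ γ) * D) * ENNReal.ofReal
          (σ ^ (-(2 * a1) - 1) * (min 1 (σ * (aF γ + bF γ))⁻¹) ^ (r1 - 1)) :=
          setLIntegral_mono' measurableSet_Ioi hσ
      _ = (ENNReal.ofReal (πγ γ) * D) * ∫⁻ σ in Set.Ioi (0 : ℝ), ENNReal.ofReal
          (σ ^ (-(2 * a1) - 1) * (min 1 (σ * (aF γ + bF γ))⁻¹) ^ (r1 - 1)) :=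
          lintegral_const_mul' _ _ (ENNReal.mul_ne_top ENNReal.ofReal_ne_top hDtop)
      _ ≤ (ENNReal.ofReal (πγ γ) * D) * ENNReal.ofReal (J * (aF γ + bF γ) ^ (- -(2 * a1))) := by
          gcongr
          exact hJ _ hH
      _ = _ := by
          rw [neg_neg, mul_comm J, ENNReal.ofReal_mul (by positivity),
            ENNReal.ofReal_mul (by positivity)]
          ring
  unfold probitTPNMarginal
  refine (setLIntegral_mono' hΓmeas hmain).trans_lt ?_
  rw [lintegral_const_mul' _ _ (ENNReal.mul_ne_top hDtop ENNReal.ofReal_ne_top)]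
  exact ENNReal.mul_lt_top
    (ENNReal.mul_lt_top hDtop.lt_top ENNReal.ofReal_lt_top) hint
end

section
/- Consider the linear mixed model with multivariate scale-mixture-of-normals random effects: each block u_i ∈ ℝ^{q_i} has density g_i(u_i|σ_i,δ) = ∫_0^∞ (τ/(2πσ_i²))^{q_i/2} exp(−τ‖u_i‖²/(2σ_i²)) dH(τ|δ), with mixing distribution H(·|δ) on (0,∞), shape parameter δ ∈ Δ with proper prior density π(δ), and prior σ_i^{−(2a_i+1)} on each σ_i (i = 0,…,r). Then the marginal likelihood factorizes exactly as m̃(y) = m_N(y) · ∫_Δ [∏_{i=1}^r ∫_0^∞ τ_i^{−a_i} dH(τ_i|δ)] π(δ) dδ, where m_N(y) is the marginal likelihood of the same model with standard normal random effects u_{ik} | σ_i ~ N(0, σ_i²) and prior ∏_{i=0}^r σ_i^{−(2a_i+1)}; in particular the ratio m̃(y)/m_N(y) does not depend on y. The identity holds as an equality of values in [0, ∞]. -/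
open MeasureTheory Real Set Matrix
open scoped ENNReal

/-- Marginal likelihood of the linear mixed model with multivariate scale-mixture-of-normals
random effects, mixing distribution `Hmix δ`, proper prior density `πδ` on `Δset`, and priors
`σ_i^{-(2 a_i + 1)}`, `i = 0, …, r`. -/
noncomputable def smnMarginal {n p r : ℕ} {qs : Fin r → ℕ}
    (X : Matrix (Fin n) (Fin p) ℝ) (Z : Matrix (Fin n) ((i : Fin r) × Fin (qs i)) ℝ)
    (Hmix : ℝ → Measure ℝ) (Δset : Set ℝ) (πδ : ℝ → ℝ)
    (a0 : ℝ) (av : Fin r → ℝ) (y : Fin n → ℝ) : ℝ≥0∞ :=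
  ∫⁻ δ in Δset,
    ∫⁻ σ in {s : Fin r → ℝ | ∀ i, 0 < s i},
      ∫⁻ σ0 in Set.Ioi (0 : ℝ),
        ∫⁻ β : Fin p → ℝ,
          ∫⁻ u : ((i : Fin r) × Fin (qs i)) → ℝ,
            ENNReal.ofReal (
              (2 * Real.pi * σ0 ^ 2) ^ (-(n : ℝ) / 2) *
                Real.exp (-(∑ j, (y j - (X.mulVec β + Z.mulVec u) j) ^ 2) / (2 * σ0 ^ 2)) *
                (∏ i, ∫ τ, (τ / (2 * Real.pi * (σ i) ^ 2)) ^ ((qs i : ℝ) / 2) *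
                    Real.exp (-τ * (∑ k, (u ⟨i, k⟩) ^ 2) / (2 * (σ i) ^ 2)) ∂(Hmix δ)) *
                σ0 ^ (-(2 * a0 + 1)) * (∏ i, (σ i) ^ (-(2 * av i + 1))) * πδ δ)

/-- Marginal likelihood of the linear mixed model with independent normal random effects
`u_{ik} | σ_i ~ N(0, σ_i²)` and priors `σ_i^{-(2 a_i + 1)}`, `i = 0, …, r`. -/
noncomputable def normalMarginalSMN {n p r : ℕ} {qs : Fin r → ℕ}
    (X : Matrix (Fin n) (Fin p) ℝ) (Z : Matrix (Fin n) ((i : Fin r) × Fin (qs i)) ℝ)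
    (a0 : ℝ) (av : Fin r → ℝ) (y : Fin n → ℝ) : ℝ≥0∞ :=
  ∫⁻ σ in {s : Fin r → ℝ | ∀ i, 0 < s i},
    ∫⁻ σ0 in Set.Ioi (0 : ℝ),
      ∫⁻ β : Fin p → ℝ,
        ∫⁻ u : ((i : Fin r) × Fin (qs i)) → ℝ,
          ENNReal.ofReal (
            (2 * Real.pi * σ0 ^ 2) ^ (-(n : ℝ) / 2) *
              Real.exp (-(∑ j, (y j - (X.mulVec β + Z.mulVec u) j) ^ 2) / (2 * σ0 ^ 2)) *
              (∏ ik : (i : Fin r) × Fin (qs i),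
                (2 * Real.pi * (σ ik.1) ^ 2) ^ (-(1 : ℝ) / 2) *
                  Real.exp (-(u ik) ^ 2 / (2 * (σ ik.1) ^ 2))) *
              σ0 ^ (-(2 * a0 + 1)) * ∏ i, (σ i) ^ (-(2 * av i + 1)))


lemma smn_lintegral_prod {r : ℕ} (H : Measure ℝ) [IsProbabilityMeasure H]
    (f : Fin r → ℝ → ℝ≥0∞) (hf : ∀ i, Measurable (f i)) :
    ∏ i, ∫⁻ t, f i t ∂H = ∫⁻ t : Fin r → ℝ, ∏ i, f i (t i) ∂(Measure.pi fun _ => H) := by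
  have h := ProbabilityTheory.lintegral_prod_eq_prod_lintegral_of_indepFun
    (μ := Measure.pi fun _ : Fin r => H) Finset.univ (fun i t => f i (t i))
    (ProbabilityTheory.iIndepFun_pi (X := f) (fun i => (hf i).aemeasurable))
    (fun i => (hf i).comp (measurable_pi_apply i))
  have h2 : ∀ i, ∫⁻ t : Fin r → ℝ, f i (t i) ∂(Measure.pi fun _ => H) = ∫⁻ t, f i t ∂H := by
    intro i
    exact (measurePreserving_eval (fun _ : Fin r => H) i).lintegral_comp (hf i)
  simp only [h2] at h
  rw [← h]

lemma smn_K_eq {q : ℕ} {t s : ℝ} (ht : 0 < t) (hs : 0 < s) (w : Fin q → ℝ) :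
    ∏ k, ((2 * Real.pi * (s / √t) ^ 2) ^ (-(1 : ℝ) / 2) *
      Real.exp (-(w k) ^ 2 / (2 * (s / √t) ^ 2))) =
    (t / (2 * Real.pi * s ^ 2)) ^ ((q : ℝ) / 2) *
      Real.exp (-t * (∑ k, (w k) ^ 2) / (2 * s ^ 2)) := by
  have h1 : (s / √t) ^ 2 = s ^ 2 / t := by rw [div_pow, Real.sq_sqrt ht.le]
  rw [h1, Finset.prod_mul_distrib, ← Real.exp_sum]
  congr 1
  · have h2 : (2 * Real.pi * (s ^ 2 / t)) = (t / (2 * Real.pi * s ^ 2))⁻¹ := by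
      field_simp
    have h3 : 0 ≤ t / (2 * Real.pi * s ^ 2) := by positivity
    rw [h2, Finset.prod_const, Finset.card_univ, Fintype.card_fin, neg_div,
      Real.rpow_neg (inv_nonneg.2 h3), Real.inv_rpow h3, inv_inv, ← Real.rpow_natCast,
      ← Real.rpow_mul h3]
    congr 1
    ring
  · congr 1
    rw [Finset.mul_sum, Finset.sum_div]
    refine Finset.sum_congr rfl fun k _ => ?_
    field_simp

lemma smn_bound {s b : ℝ} (hs : 0 < s) (hb : 0 < b) {x : ℝ} (hx : 0 ≤ x) :
    x ^ s * Real.exp (-(b * x)) ≤ (s / b) ^ s := by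
  have h1 : x = (s / b) * (b / s * x) := by field_simp
  have h2 : (b / s * x) ^ s ≤ Real.exp (b * x) := by
    calc (b / s * x) ^ s ≤ (Real.exp (b / s * x)) ^ s := by
          apply Real.rpow_le_rpow (by positivity) _ hs.le
          linarith [Real.add_one_le_exp (b / s * x)]
      _ = Real.exp (b * x) := by
          rw [← Real.exp_mul]
          congr 1
          field_simp
  calc x ^ s * Real.exp (-(b * x)) = (s / b) ^ s * (b / s * x) ^ s * Real.exp (-(b * x)) := by
        rw [← Real.mul_rpow (by positivity) (by positivity), ← h1]
    _ ≤ (s / b) ^ s * Real.exp (b * x) * Real.exp (-(b * x)) := by gcongr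
    _ = (s / b) ^ s := by rw [mul_assoc, ← Real.exp_add]; simp

lemma smn_inner {q : ℕ} (H : Measure ℝ) [IsProbabilityMeasure H]
    (hH : ∀ᵐ t ∂H, 0 < t) {s : ℝ} (hs : 0 < s) (w : Fin q → ℝ) (hw : ∀ k, w k ≠ 0) :
    ENNReal.ofReal (∫ t, (t / (2 * Real.pi * s ^ 2)) ^ ((q : ℝ) / 2) *
      Real.exp (-t * (∑ k, (w k) ^ 2) / (2 * s ^ 2)) ∂H) =
    ∫⁻ t, ENNReal.ofReal (∏ k, ((2 * Real.pi * (s / √t) ^ 2) ^ (-(1 : ℝ) / 2) *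
      Real.exp (-(w k) ^ 2 / (2 * (s / √t) ^ 2)))) ∂H := by
  have hmeas : Measurable fun t : ℝ => (t / (2 * Real.pi * s ^ 2)) ^ ((q : ℝ) / 2) *
      Real.exp (-t * (∑ k, (w k) ^ 2) / (2 * s ^ 2)) := by fun_prop
  rw [ofReal_integral_eq_lintegral_ofReal]
  · refine lintegral_congr_ae ?_
    filter_upwards [hH] with t ht
    rw [smn_K_eq ht hs]
  · obtain ⟨C, hC⟩ : ∃ C : ℝ, ∀ t : ℝ, 0 < t → (t / (2 * Real.pi * s ^ 2)) ^ ((q : ℝ) / 2) *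
        Real.exp (-t * (∑ k, (w k) ^ 2) / (2 * s ^ 2)) ≤ C := by
      rcases Nat.eq_zero_or_pos q with hq | hq
      · subst hq
        exact ⟨1, fun t _ => by simp⟩
      · have hS : 0 < ∑ k, (w k) ^ 2 :=
          Finset.sum_pos (fun k _ => by have := hw k; positivity) ⟨⟨0, hq⟩, Finset.mem_univ _⟩
        have hq' : (0 : ℝ) < (q : ℝ) / 2 := by positivity
        have hb : 0 < Real.pi * ∑ k, (w k) ^ 2 := by positivity
        refine ⟨_, fun t ht => le_trans (le_of_eq ?_)
          (smn_bound hq' hb (x := t / (2 * Real.pi * s ^ 2)) (by positivity))⟩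
        congr 2
        field_simp
    refine Integrable.of_bound hmeas.aestronglyMeasurable C ?_
    filter_upwards [hH] with t ht
    rw [Real.norm_of_nonneg (by positivity)]
    exact hC t ht
  · filter_upwards [hH] with t ht
    have : (0 : ℝ) ≤ (t / (2 * Real.pi * s ^ 2)) := by positivity
    simp only [Pi.zero_apply]
    positivity

lemma smn_scale {r : ℕ} (G : (Fin r → ℝ) → ℝ≥0∞) (hG : Measurable G) (av : Fin r → ℝ)
    (t : Fin r → ℝ) (ht : ∀ i, 0 < t i) :
    ∫⁻ s in {s : Fin r → ℝ | ∀ i, 0 < s i},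
      G (fun i => s i / √(t i)) * ∏ i, ENNReal.ofReal ((s i) ^ (-(2 * av i + 1))) =
    (∏ i, ENNReal.ofReal ((t i) ^ (-(av i)))) *
      ∫⁻ s in {s : Fin r → ℝ | ∀ i, 0 < s i},
        G s * ∏ i, ENNReal.ofReal ((s i) ^ (-(2 * av i + 1))) := by
  classical
  have hS : MeasurableSet {s : Fin r → ℝ | ∀ i, 0 < s i} := by
    have : {s : Fin r → ℝ | ∀ i, 0 < s i} = Set.pi Set.univ fun _ => Set.Ioi 0 := by
      ext; simp
    rw [this]
    exact MeasurableSet.univ_pi fun _ => measurableSet_Ioi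
  have hsq : ∀ i, 0 < √(t i) := fun i => Real.sqrt_pos.2 (ht i)
  have hdet : det (diagonal fun i => √(t i)) ≠ 0 := by
    rw [det_diagonal]
    exact (Finset.prod_pos fun i _ => hsq i).ne'
  have hvol := Real.smul_map_diagonal_volume_pi hdet
  have hF : Measurable fun s : Fin r → ℝ => G (fun i => s i / √(t i)) *
      ∏ i, ENNReal.ofReal ((s i) ^ (-(2 * av i + 1))) := by fun_prop
  rw [← lintegral_indicator hS]
  conv_lhs => rw [← hvol]
  rw [lintegral_smul_measure, lintegral_map (hF.indicator hS)
    (Continuous.measurable (LinearMap.continuous_on_pi _)), ← lintegral_indicator hS, smul_eq_mul,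
    det_diagonal, abs_of_pos (Finset.prod_pos fun i _ => hsq i),
    ENNReal.ofReal_prod_of_nonneg (fun i _ => (hsq i).le),
    ← lintegral_const_mul _ (by
      exact (hF.indicator hS).comp (Continuous.measurable (LinearMap.continuous_on_pi _))),
    ← lintegral_const_mul _ (Measurable.indicator (by fun_prop) hS)]
  refine lintegral_congr fun s => ?_
  have hD : (toLin' (diagonal fun i => √(t i))) s = fun i => √(t i) * s i := by
    ext i
    simp [mulVec_diagonal]
  rw [hD]
  by_cases hs : ∀ i, 0 < s i
  · rw [Set.indicator_of_mem (by exact fun i => mul_pos (hsq i) (hs i)),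
      Set.indicator_of_mem (by exact hs)]
    have h1 : (fun i => √(t i) * s i / √(t i)) = s := by
      ext i
      have := (hsq i).ne'
      field_simp
    rw [h1, mul_left_comm, mul_left_comm _ (G s), ← Finset.prod_mul_distrib,
      ← Finset.prod_mul_distrib]
    congr 1
    refine Finset.prod_congr rfl fun i _ => ?_
    rw [← ENNReal.ofReal_mul (hsq i).le, ← ENNReal.ofReal_mul (Real.rpow_nonneg (ht i).le _)]
    congr 1
    rw [Real.mul_rpow (hsq i).le (hs i).le, ← mul_assoc]
    congr 1
    rw [Real.sqrt_eq_rpow, ← Real.rpow_mul (ht i).le, ← Real.rpow_add (ht i)]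
    congr 1
    ring
  · rw [Set.indicator_of_notMem (by
      exact fun h => hs fun i => (mul_pos_iff_of_pos_left (hsq i)).1 (h i)),
      Set.indicator_of_notMem (by exact hs)]
    simp

lemma smn_nested {p : ℕ} {ι : Type*} [Fintype ι]
    (f : ℝ × (Fin p → ℝ) × (ι → ℝ) → ℝ≥0∞) (hf : Measurable f) :
    ∫⁻ σ0 in Set.Ioi (0 : ℝ), ∫⁻ β : Fin p → ℝ, ∫⁻ u : ι → ℝ, f (σ0, β, u) =
    ∫⁻ z, f z ∂((volume.restrict (Set.Ioi (0 : ℝ))).prod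
      ((volume : Measure (Fin p → ℝ)).prod (volume : Measure (ι → ℝ)))) := by
  rw [lintegral_prod _ hf.aemeasurable]
  refine lintegral_congr fun s => ?_
  rw [lintegral_prod _ (by fun_prop)]

/-- Error density times the prior of the error scale. -/
noncomputable def smnL {n p r : ℕ} {qs : Fin r → ℕ}
    (X : Matrix (Fin n) (Fin p) ℝ) (Z : Matrix (Fin n) ((i : Fin r) × Fin (qs i)) ℝ)
    (a0 : ℝ) (y : Fin n → ℝ) (z : ℝ × (Fin p → ℝ) × (((i : Fin r) × Fin (qs i)) → ℝ)) : ℝ≥0∞ :=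
  ENNReal.ofReal ((2 * Real.pi * z.1 ^ 2) ^ (-(n : ℝ) / 2) *
    Real.exp (-(∑ j, (y j - (X.mulVec z.2.1 + Z.mulVec z.2.2) j) ^ 2) / (2 * z.1 ^ 2))) *
    ENNReal.ofReal (z.1 ^ (-(2 * a0 + 1)))

/-- Normal density of one block of random effects. -/
noncomputable def smnK {r : ℕ} (qs : Fin r → ℕ) (i : Fin r) (s : ℝ)
    (u : ((i : Fin r) × Fin (qs i)) → ℝ) : ℝ≥0∞ :=
  ENNReal.ofReal (∏ k, ((2 * Real.pi * s ^ 2) ^ (-(1 : ℝ) / 2) *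
      Real.exp (-(u ⟨i, k⟩) ^ 2 / (2 * s ^ 2))))

lemma smnL_meas {n p r : ℕ} {qs : Fin r → ℕ}
    (X : Matrix (Fin n) (Fin p) ℝ) (Z : Matrix (Fin n) ((i : Fin r) × Fin (qs i)) ℝ)
    (a0 : ℝ) (y : Fin n → ℝ) : Measurable (smnL X Z a0 y) := by
  unfold smnL
  simp only [Pi.add_apply, mulVec, dotProduct]
  fun_prop

lemma smnK_meas {r : ℕ} {qs : Fin r → ℕ} (i : Fin r) :
    Measurable (fun z : ℝ × (((i : Fin r) × Fin (qs i)) → ℝ) => smnK qs i z.1 z.2) := by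
  unfold smnK
  fun_prop

attribute [irreducible] smnL smnK

/-- The normal likelihood with random-effect scales `s`, all else integrated out. -/
noncomputable def smnG {n p r : ℕ} {qs : Fin r → ℕ}
    (X : Matrix (Fin n) (Fin p) ℝ) (Z : Matrix (Fin n) ((i : Fin r) × Fin (qs i)) ℝ)
    (a0 : ℝ) (y : Fin n → ℝ) (s : Fin r → ℝ) : ℝ≥0∞ :=
  ∫⁻ z, smnL X Z a0 y z * ∏ i, smnK qs i (s i) z.2.2 ∂((volume.restrict (Set.Ioi (0 : ℝ))).prod
      ((volume : Measure (Fin p → ℝ)).prod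
        (volume : Measure (((i : Fin r) × Fin (qs i)) → ℝ))))

set_option maxHeartbeats 400000 in
lemma smnG_integrand_meas {n p r : ℕ} {qs : Fin r → ℕ}
    (X : Matrix (Fin n) (Fin p) ℝ) (Z : Matrix (Fin n) ((i : Fin r) × Fin (qs i)) ℝ)
    (a0 : ℝ) (y : Fin n → ℝ) :
    Measurable (fun w : (Fin r → ℝ) × (ℝ × (Fin p → ℝ) × (((i : Fin r) × Fin (qs i)) → ℝ)) =>
      smnL X Z a0 y w.2 * ∏ i, smnK qs i (w.1 i) w.2.2.2) := by
  refine ((smnL_meas X Z a0 y).comp measurable_snd).mul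
    (Finset.measurable_fun_prod _ fun i _ => ?_)
  have h : Measurable fun w : (Fin r → ℝ) ×
      (ℝ × (Fin p → ℝ) × (((i : Fin r) × Fin (qs i)) → ℝ)) => (w.1 i, w.2.2.2) :=
    ((measurable_pi_apply i).comp measurable_fst).prodMk
      (measurable_snd.comp (measurable_snd.comp measurable_snd))
  have h2 := (smnK_meas (qs := qs) i).comp h
  exact h2

lemma smnG_meas {n p r : ℕ} {qs : Fin r → ℕ}
    (X : Matrix (Fin n) (Fin p) ℝ) (Z : Matrix (Fin n) ((i : Fin r) × Fin (qs i)) ℝ)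
    (a0 : ℝ) (y : Fin n → ℝ) : Measurable (smnG X Z a0 y) :=
  (smnG_integrand_meas X Z a0 y).lintegral_prod_right'

lemma smn_pos_meas (r : ℕ) : MeasurableSet {s : Fin r → ℝ | ∀ i, 0 < s i} := by
  have : {s : Fin r → ℝ | ∀ i, 0 < s i} = Set.pi Set.univ fun _ => Set.Ioi 0 := by
    ext; simp
  rw [this]
  exact MeasurableSet.univ_pi fun _ => measurableSet_Ioi

set_option maxHeartbeats 400000 in
lemma smn_normal_eq {n p r : ℕ} {qs : Fin r → ℕ}
    (X : Matrix (Fin n) (Fin p) ℝ) (Z : Matrix (Fin n) ((i : Fin r) × Fin (qs i)) ℝ)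
    (a0 : ℝ) (av : Fin r → ℝ) (y : Fin n → ℝ) :
    normalMarginalSMN X Z a0 av y =
      ∫⁻ s in {s : Fin r → ℝ | ∀ i, 0 < s i},
        smnG X Z a0 y s * ∏ i, ENNReal.ofReal ((s i) ^ (-(2 * av i + 1))) := by
  unfold normalMarginalSMN
  refine setLIntegral_congr_fun (smn_pos_meas r) fun s hs => ?_
  have hs' : ∀ i, 0 < s i := hs
  have hm : Measurable fun z : ℝ × (Fin p → ℝ) × (((i : Fin r) × Fin (qs i)) → ℝ) =>
      smnL X Z a0 y z * ∏ i, smnK qs i (s i) z.2.2 :=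
    (smnG_integrand_meas X Z a0 y).comp measurable_prodMk_left
  simp only [smnG]
  rw [← lintegral_mul_const _ hm, ← smn_nested (fun z => (smnL X Z a0 y z * ∏ i, smnK qs i (s i) z.2.2) * ∏ i, ENNReal.ofReal ((s i) ^ (-(2 * av i + 1)))) (hm.mul_const _)]
  refine setLIntegral_congr_fun measurableSet_Ioi fun σ0 h0 => ?_
  have h0' : 0 < σ0 := h0
  refine lintegral_congr fun β => lintegral_congr fun u => ?_
  simp only [smnL, smnK]
  rw [← ENNReal.ofReal_prod_of_nonneg (fun i _ => by positivity),
    ← ENNReal.ofReal_prod_of_nonneg (fun i _ => Real.rpow_nonneg (hs' i).le _),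
    ← ENNReal.ofReal_mul (by positivity), ← ENNReal.ofReal_mul (by positivity),
    ← ENNReal.ofReal_mul (by positivity), ← Finset.univ_sigma_univ, Finset.prod_sigma]
  congr 1
  ring

set_option maxHeartbeats 400000 in
lemma smn_fixed {n p r : ℕ} {qs : Fin r → ℕ}
    (X : Matrix (Fin n) (Fin p) ℝ) (Z : Matrix (Fin n) ((i : Fin r) × Fin (qs i)) ℝ)
    (a0 : ℝ) (av : Fin r → ℝ) (y : Fin n → ℝ) (H : Measure ℝ) [IsProbabilityMeasure H]
    (hH : ∀ᵐ t ∂H, 0 < t) (c : ℝ) (hc : 0 ≤ c) :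
    ∫⁻ σ in {s : Fin r → ℝ | ∀ i, 0 < s i},
      ∫⁻ σ0 in Set.Ioi (0 : ℝ),
        ∫⁻ β : Fin p → ℝ,
          ∫⁻ u : ((i : Fin r) × Fin (qs i)) → ℝ,
            ENNReal.ofReal (
              (2 * Real.pi * σ0 ^ 2) ^ (-(n : ℝ) / 2) *
                Real.exp (-(∑ j, (y j - (X.mulVec β + Z.mulVec u) j) ^ 2) / (2 * σ0 ^ 2)) *
                (∏ i, ∫ τ, (τ / (2 * Real.pi * (σ i) ^ 2)) ^ ((qs i : ℝ) / 2) *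
                    Real.exp (-τ * (∑ k, (u ⟨i, k⟩) ^ 2) / (2 * (σ i) ^ 2)) ∂H) *
                σ0 ^ (-(2 * a0 + 1)) * (∏ i, (σ i) ^ (-(2 * av i + 1))) * c) =
    normalMarginalSMN X Z a0 av y *
      ((∏ i, ∫⁻ τ, ENNReal.ofReal (τ ^ (-(av i))) ∂H) * ENNReal.ofReal c) := by
  have hpi : ∀ᵐ t ∂(Measure.pi fun _ : Fin r => H), ∀ i, 0 < t i :=
    Filter.eventually_all.2 fun i => Measure.tendsto_eval_ae_ae.eventually hH
  have step1 : ∀ s ∈ {s : Fin r → ℝ | ∀ i, 0 < s i},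
      (∫⁻ σ0 in Set.Ioi (0 : ℝ),
        ∫⁻ β : Fin p → ℝ,
          ∫⁻ u : ((i : Fin r) × Fin (qs i)) → ℝ,
            ENNReal.ofReal (
              (2 * Real.pi * σ0 ^ 2) ^ (-(n : ℝ) / 2) *
                Real.exp (-(∑ j, (y j - (X.mulVec β + Z.mulVec u) j) ^ 2) / (2 * σ0 ^ 2)) *
                (∏ i, ∫ τ, (τ / (2 * Real.pi * (s i) ^ 2)) ^ ((qs i : ℝ) / 2) *
                    Real.exp (-τ * (∑ k, (u ⟨i, k⟩) ^ 2) / (2 * (s i) ^ 2)) ∂H) *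
                σ0 ^ (-(2 * a0 + 1)) * (∏ i, (s i) ^ (-(2 * av i + 1))) * c)) =
      (∫⁻ t, smnG X Z a0 y (fun i => s i / √(t i)) *
        ∏ i, ENNReal.ofReal ((s i) ^ (-(2 * av i + 1))) ∂(Measure.pi fun _ : Fin r => H)) *
        ENNReal.ofReal c := by
    intro s hs
    have hs' : ∀ i, 0 < s i := hs
    have hm2 : Measurable fun w : (Fin r → ℝ) ×
        (ℝ × (Fin p → ℝ) × (((i : Fin r) × Fin (qs i)) → ℝ)) =>
        smnL X Z a0 y w.2 * ∏ i, smnK qs i (s i / √(w.1 i)) w.2.2.2 :=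
      (smnG_integrand_meas X Z a0 y).comp (by fun_prop :
        Measurable fun w : (Fin r → ℝ) ×
        (ℝ × (Fin p → ℝ) × (((i : Fin r) × Fin (qs i)) → ℝ)) =>
          ((fun i => s i / √(w.1 i) : Fin r → ℝ), w.2))
    have hGs : Measurable fun t : Fin r → ℝ => smnG X Z a0 y (fun i => s i / √(t i)) :=
      (smnG_meas X Z a0 y).comp (by fun_prop)
    have hm3 : Measurable fun z : ℝ × (Fin p → ℝ) × (((i : Fin r) × Fin (qs i)) → ℝ) =>
        ∫⁻ t, smnL X Z a0 y z * ∏ i, smnK qs i (s i / √(t i)) z.2.2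
          ∂(Measure.pi fun _ : Fin r => H) := hm2.lintegral_prod_left'
    rw [lintegral_mul_const _ hGs]
    simp only [smnG]
    rw [mul_assoc, lintegral_lintegral_swap (μ := Measure.pi fun _ : Fin r => H) (by exact hm2.aemeasurable),
      ← lintegral_mul_const _ hm3, ← smn_nested _ (hm3.mul_const _)]
    refine setLIntegral_congr_fun measurableSet_Ioi fun σ0 h0 => ?_
    have h0' : 0 < σ0 := h0
    refine lintegral_congr fun β => lintegral_congr_ae ?_
    have hu : ∀ᵐ u : ((i : Fin r) × Fin (qs i)) → ℝ, ∀ ik, u ik ≠ 0 :=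
      Filter.eventually_all.2 fun ik => Measure.ae_eval_ne _ ik 0
    filter_upwards [hu] with u hu
    have hK : ∀ i, Measurable fun t : ℝ => smnK qs i (s i / √t) u := fun i =>
      (smnK_meas (qs := qs) i).comp (by fun_prop : Measurable fun t : ℝ => (s i / √t, u))
    have hKp : Measurable fun t : Fin r → ℝ => ∏ i, smnK qs i (s i / √(t i)) u :=
      Finset.measurable_fun_prod _ fun i _ => (hK i).comp (measurable_pi_apply i)
    rw [lintegral_const_mul _ hKp,
      ← smn_lintegral_prod H (fun i t => smnK qs i (s i / √t) u) hK]
    have hI : ∀ i, ∫⁻ t, smnK qs i (s i / √t) u ∂H = ENNReal.ofReal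
        (∫ τ, (τ / (2 * Real.pi * (s i) ^ 2)) ^ ((qs i : ℝ) / 2) *
          Real.exp (-τ * (∑ k, (u ⟨i, k⟩) ^ 2) / (2 * (s i) ^ 2)) ∂H) := fun i => by
      simp only [smnK]
      exact (smn_inner H hH (hs' i) (fun k => u ⟨i, k⟩) (fun k => hu _)).symm
    have hnn : ∀ i, 0 ≤ ∫ τ, (τ / (2 * Real.pi * (s i) ^ 2)) ^ ((qs i : ℝ) / 2) *
          Real.exp (-τ * (∑ k, (u ⟨i, k⟩) ^ 2) / (2 * (s i) ^ 2)) ∂H := fun i => by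
      refine integral_nonneg_of_ae ?_
      filter_upwards [hH] with t ht
      simp only [Pi.zero_apply]
      positivity
    simp only [hI]
    have hP : 0 ≤ ∏ i, ∫ τ, (τ / (2 * Real.pi * (s i) ^ 2)) ^ ((qs i : ℝ) / 2) *
          Real.exp (-τ * (∑ k, (u ⟨i, k⟩) ^ 2) / (2 * (s i) ^ 2)) ∂H :=
      Finset.prod_nonneg fun i _ => hnn i
    rw [← ENNReal.ofReal_prod_of_nonneg (fun i _ => hnn i),
      ← ENNReal.ofReal_prod_of_nonneg (fun i _ => Real.rpow_nonneg (hs' i).le _)]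
    generalize (∏ i, ∫ τ, (τ / (2 * Real.pi * (s i) ^ 2)) ^ ((qs i : ℝ) / 2) *
          Real.exp (-τ * (∑ k, (u ⟨i, k⟩) ^ 2) / (2 * (s i) ^ 2)) ∂H) = P at hP ⊢
    have hQ : 0 ≤ ∏ i, (s i) ^ (-(2 * av i + 1)) :=
      Finset.prod_nonneg fun i _ => Real.rpow_nonneg (hs' i).le _
    generalize (∏ i, (s i) ^ (-(2 * av i + 1))) = Q at hQ ⊢
    simp only [smnL]
    rw [← ENNReal.ofReal_mul hQ, ← ENNReal.ofReal_mul (by positivity),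
      ← ENNReal.ofReal_mul (by positivity), ← ENNReal.ofReal_mul (by positivity)]
    congr 1
    ring
  rw [setLIntegral_congr_fun (smn_pos_meas r) step1]
  have hm4 : Measurable fun w : (Fin r → ℝ) × (Fin r → ℝ) =>
      smnG X Z a0 y (fun i => w.1 i / √(w.2 i)) *
        ∏ i, ENNReal.ofReal ((w.1 i) ^ (-(2 * av i + 1))) :=
    ((smnG_meas X Z a0 y).comp (by fun_prop)).mul (by fun_prop)
  rw [lintegral_mul_const _ hm4.lintegral_prod_right', lintegral_lintegral_swap
    (by exact hm4.aemeasurable)]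
  have step2 : ∀ᵐ t ∂(Measure.pi fun _ : Fin r => H),
      ∫⁻ s in {s : Fin r → ℝ | ∀ i, 0 < s i}, smnG X Z a0 y (fun i => s i / √(t i)) *
        ∏ i, ENNReal.ofReal ((s i) ^ (-(2 * av i + 1))) =
      (∏ i, ENNReal.ofReal ((t i) ^ (-(av i)))) * normalMarginalSMN X Z a0 av y := by
    filter_upwards [hpi] with t ht
    rw [smn_scale _ (smnG_meas X Z a0 y) av t ht, smn_normal_eq]
  rw [lintegral_congr_ae step2, lintegral_mul_const _ (by fun_prop),
    ← smn_lintegral_prod H (fun i t => ENNReal.ofReal (t ^ (-(av i)))) (fun i => by fun_prop)]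
  ring

/-- Exact factorization of the marginal likelihood of the linear mixed model
with multivariate scale-mixture-of-normals random effects:
`m̃(y) = m_N(y) · ∫_Δ [∏ᵢ ∫₀^∞ τᵢ^{-aᵢ} dH(τᵢ|δ)] π(δ) dδ`, an equality in `[0,∞]`;
in particular the ratio `m̃(y)/m_N(y)` does not depend on `y`. -/
theorem smn_marginal_factorization
    {n p r : ℕ} {qs : Fin r → ℕ}
    (X : Matrix (Fin n) (Fin p) ℝ) (Z : Matrix (Fin n) ((i : Fin r) × Fin (qs i)) ℝ)
    (Hmix : ℝ → Measure ℝ) (Δset : Set ℝ) (πδ : ℝ → ℝ)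
    (a0 : ℝ) (av : Fin r → ℝ)
    (hnp : p < n) (hX : X.rank = p)
    (hΔmeas : MeasurableSet Δset)
    (hHmeas : Measurable Hmix)
    -- `Hmix δ` is a mixing (probability) distribution supported on (0,∞)
    (hHprob : ∀ δ ∈ Δset, IsProbabilityMeasure (Hmix δ))
    (hHsupp : ∀ δ ∈ Δset, Hmix δ (Set.Ioi (0 : ℝ))ᶜ = 0)
    -- `πδ` is a proper prior density on `Δset`
    (hπmeas : Measurable πδ)
    (hπnonneg : ∀ δ ∈ Δset, 0 ≤ πδ δ)
    (hπproper : ∫ δ in Δset, πδ δ = 1)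
    (y : Fin n → ℝ) :
    smnMarginal X Z Hmix Δset πδ a0 av y =
      normalMarginalSMN X Z a0 av y *
        ∫⁻ δ in Δset,
          (∏ i, ∫⁻ τ in Set.Ioi (0 : ℝ), ENNReal.ofReal (τ ^ (-(av i))) ∂(Hmix δ)) *
            ENNReal.ofReal (πδ δ) := by
  have hres : ∀ δ ∈ Δset, (Hmix δ).restrict (Set.Ioi 0) = Hmix δ := fun δ hδ =>
    Measure.restrict_eq_self_of_ae_mem (hHsupp δ hδ)
  have hf : Measurable fun δ =>
      (∏ i, ∫⁻ τ in Set.Ioi (0 : ℝ), ENNReal.ofReal (τ ^ (-(av i))) ∂(Hmix δ)) *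
            ENNReal.ofReal (πδ δ) := by
    refine (Finset.measurable_fun_prod _ fun i _ => ?_).mul hπmeas.ennreal_ofReal
    simp only [← lintegral_indicator measurableSet_Ioi]
    exact (Measure.measurable_lintegral
      (Measurable.indicator (by fun_prop) measurableSet_Ioi)).comp hHmeas
  rw [← lintegral_const_mul _ hf]
  unfold smnMarginal
  refine setLIntegral_congr_fun hΔmeas fun δ hδ => ?_
  have := hHprob δ hδ
  simp only [hres δ hδ]
  exact smn_fixed X Z a0 av y (Hmix δ) (hHsupp δ hδ) (πδ δ) (hπnonneg δ hδ)
end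

section
/- Let two multivariate scale-mixture-of-normals specifications for the random effects of the linear mixed model be given, with mixing distributions H_1(·|δ), H_2(·|δ) and proper priors π_1(δ), π_2(δ), and let C_j = ∫_Δ [∏_{i=1}^r ∫_0^∞ τ_i^{−a_i} dH_j(τ_i|δ)] π_j(δ) dδ for j = 1, 2. If 0 < C_1, C_2 < ∞, then for every y ∈ ℝ^n with 0 < m_N(y) < ∞, the Bayes factor between the two models satisfies m̃_1(y)/m̃_2(y) = C_1/C_2; in particular it does not depend on the data y. -/
open MeasureTheory Real Set Matrix
open scoped ENNReal

/-- The Gaussian kernel with precision multiplier `τ`, times the prior power of `s`. -/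
noncomputable def gbKer (q : ℕ) (a τ s S : ℝ) : ℝ :=
  (τ / (2 * Real.pi * s ^ 2)) ^ ((q : ℝ) / 2) * Real.exp (-τ * S / (2 * s ^ 2)) *
    s ^ (-(2 * a + 1))

lemma gbKer_measurable (q : ℕ) (a : ℝ) :
    Measurable (fun x : ℝ × ℝ × ℝ => gbKer q a x.1 x.2.1 x.2.2) := by
  unfold gbKer
  fun_prop

lemma gbKer_scale (q : ℕ) (a τ t S : ℝ) (hτ : 0 < τ) (ht : 0 < t) :
    gbKer q a τ (√τ * t) S = √τ ^ (-(2 * a + 1)) * gbKer q a 1 t S := by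
  have hs : 0 < √τ := Real.sqrt_pos.2 hτ
  have hsq : √τ ^ 2 = τ := Real.sq_sqrt hτ.le
  unfold gbKer
  rw [Real.mul_rpow hs.le ht.le, mul_pow, hsq]
  have h1 : τ / (2 * Real.pi * (τ * t ^ 2)) = 1 / (2 * Real.pi * t ^ 2) := by
    field_simp
  have h2 : -τ * S / (2 * (τ * t ^ 2)) = -1 * S / (2 * t ^ 2) := by
    field_simp
  rw [h1, h2]
  ring

lemma lintegral_Ioi_scale (c : ℝ) (hc : 0 < c) (g : ℝ → ℝ≥0∞) :
    ∫⁻ s in Ioi (0 : ℝ), g s = ∫⁻ t in Ioi (0 : ℝ), ENNReal.ofReal c * g (c * t) := by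
  have h := lintegral_image_eq_lintegral_abs_deriv_mul (s := Ioi (0 : ℝ)) (f := fun t => c * t)
    (f' := fun _ => c) measurableSet_Ioi
    (fun x _ => by simpa using ((hasDerivAt_id x).const_mul c).hasDerivWithinAt)
    (fun x _ y _ hxy => mul_left_cancel₀ hc.ne' hxy) g
  have him : (fun t => c * t) '' Ioi (0 : ℝ) = Ioi 0 := by
    ext x
    simp only [mem_image, mem_Ioi]
    constructor
    · rintro ⟨t, ht, rfl⟩
      positivity
    · intro hx
      exact ⟨x / c, by positivity, by field_simp⟩
  rw [him, abs_of_pos hc] at h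
  exact h

lemma gbKer_lintegral (q : ℕ) (a τ S : ℝ) (hτ : 0 < τ) :
    ∫⁻ s in Ioi (0 : ℝ), ENNReal.ofReal (gbKer q a τ s S) =
      ENNReal.ofReal (τ ^ (-a)) * ∫⁻ s in Ioi (0 : ℝ), ENNReal.ofReal (gbKer q a 1 s S) := by
  have hs : 0 < √τ := Real.sqrt_pos.2 hτ
  rw [lintegral_Ioi_scale (√τ) hs, ← lintegral_const_mul' _ _ ENNReal.ofReal_ne_top]
  refine setLIntegral_congr_fun measurableSet_Ioi fun t ht => ?_
  rw [gbKer_scale q a τ t S hτ ht, ← ENNReal.ofReal_mul hs.le, ← mul_assoc,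
    ← ENNReal.ofReal_mul (by positivity)]
  congr 2
  have h1 : √τ * √τ ^ (-(2 * a + 1)) = √τ ^ (1 + -(2 * a + 1)) := by
    rw [Real.rpow_add hs, Real.rpow_one]
  rw [h1, Real.sqrt_eq_rpow, ← Real.rpow_mul hτ.le]
  congr 1
  ring

lemma mix_lintegral (q : ℕ) (a S : ℝ) (H : Measure ℝ) [IsProbabilityMeasure H] :
    ∫⁻ s in Ioi (0 : ℝ), ∫⁻ τ in Ioi (0 : ℝ), ENNReal.ofReal (gbKer q a τ s S) ∂H =
      (∫⁻ τ in Ioi (0 : ℝ), ENNReal.ofReal (τ ^ (-a)) ∂H) *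
        ∫⁻ s in Ioi (0 : ℝ), ENNReal.ofReal (gbKer q a 1 s S) := by
  have hm : Measurable (fun x : ℝ × ℝ => ENNReal.ofReal (gbKer q a x.2 x.1 S)) :=
    ((gbKer_measurable q a).comp
      (measurable_snd.prodMk (measurable_fst.prodMk measurable_const))).ennreal_ofReal
  rw [lintegral_lintegral_swap hm.aemeasurable, ← lintegral_mul_const _ (by fun_prop)]
  refine setLIntegral_congr_fun measurableSet_Ioi fun τ hτ => ?_
  exact gbKer_lintegral q a τ S hτ

lemma lintegral_pi_prod : ∀ {r : ℕ} (μ : Fin r → Measure ℝ) [∀ i, SigmaFinite (μ i)]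
    (f : Fin r → ℝ → ℝ≥0∞) (_ : ∀ i, Measurable (f i)),
    ∫⁻ x, ∏ i, f i (x i) ∂(Measure.pi μ) = ∏ i, ∫⁻ x, f i x ∂(μ i)
  | 0, μ, _, f, hf => by simp
  | r + 1, μ, _, f, hf => by
    have hmp := (measurePreserving_piFinSuccAbove μ 0).symm
    rw [← hmp.lintegral_comp_emb (MeasurableEquiv.measurableEmbedding _), lintegral_prod]
    · simp only [Fin.prod_univ_succ]
      simp only [MeasurableEquiv.piFinSuccAbove_symm_apply, Fin.insertNthEquiv,
        Fin.insertNth_zero, Equiv.coe_fn_mk, Fin.cons_zero, Fin.cons_succ, Fin.zero_succAbove]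
      have ih := lintegral_pi_prod (fun i : Fin r => μ i.succ) (fun i => f i.succ)
        (fun i => hf _)
      have hmi : Measurable fun x : Fin r → ℝ => ∏ i, f i.succ (x i) :=
        Finset.measurable_prod _ fun i _ => (hf _).comp (measurable_pi_apply i)
      rw [← ih, ← lintegral_mul_const _ (hf 0)]
      refine lintegral_congr fun x => ?_
      rw [← lintegral_const_mul _ hmi]
      rfl
    · have : Measurable fun x : Fin (r+1) → ℝ => ∏ i, f i (x i) :=
        Finset.measurable_prod _ fun i _ => (hf _).comp (measurable_pi_apply i)
      exact (this.comp (MeasurableEquiv.measurable _)).aemeasurable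

lemma gauss_integrable (q : ℕ) (s S : ℝ) (hs : 0 < s) (hS : 0 ≤ S) (hq : q = 0 ∨ 0 < S)
    (H : Measure ℝ) [IsProbabilityMeasure H] (hH : H (Ioi (0 : ℝ))ᶜ = 0) :
    Integrable (fun τ : ℝ => (τ / (2 * Real.pi * s ^ 2)) ^ ((q : ℝ) / 2) *
      Real.exp (-τ * S / (2 * s ^ 2))) H := by
  have hae : ∀ᵐ τ ∂H, τ ∈ Ioi (0 : ℝ) := by
    rw [ae_iff]; exact hH
  obtain ⟨M, hM⟩ : ∃ M : ℝ, ∀ τ ∈ Ioi (0 : ℝ), ‖(τ / (2 * Real.pi * s ^ 2)) ^ ((q : ℝ) / 2) *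
      Real.exp (-τ * S / (2 * s ^ 2))‖ ≤ M := by
    rcases Nat.eq_zero_or_pos q with h0 | hqp
    · refine ⟨1, fun τ hτ => ?_⟩
      have hτ' : 0 < τ := hτ
      subst h0
      simp only [CharP.cast_eq_zero, zero_div, Real.rpow_zero, one_mul, Real.norm_eq_abs,
        Real.abs_exp, Real.exp_le_one_iff]
      rw [neg_mul, neg_div]
      have : 0 ≤ τ * S / (2 * s ^ 2) := by positivity
      linarith
    · have hSp : 0 < S := by
        rcases hq with h | h
        · omega
        · exact h
      set k : ℝ := (q : ℝ) / 2 with hk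
      have hkp : 0 < k := by positivity
      refine ⟨(k / (Real.pi * S)) ^ k, fun τ hτ => ?_⟩
      have hτ' : 0 < τ := hτ
      rw [Real.norm_of_nonneg (by positivity)]
      set b : ℝ := τ * S / (2 * s ^ 2) with hb
      have hbp : 0 < b := by positivity
      have h1 : τ / (2 * Real.pi * s ^ 2) = (b / k) * (k / (Real.pi * S)) := by
        rw [hb]; field_simp
      have h2 : -τ * S / (2 * s ^ 2) = -b := by rw [hb]; ring
      have h3 : (b / k) ^ k ≤ Real.exp b := by
        have h4 : b / k ≤ Real.exp (b / k) := by
          have := Real.add_one_le_exp (b / k); linarith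
        calc (b / k) ^ k ≤ (Real.exp (b / k)) ^ k :=
              Real.rpow_le_rpow (by positivity) h4 hkp.le
          _ = Real.exp b := by rw [← Real.exp_mul]; congr 1; field_simp
      rw [h1, h2, Real.mul_rpow (by positivity) (by positivity), Real.exp_neg]
      have h5 : 0 < Real.exp b := Real.exp_pos b
      have h6 : 0 ≤ (k / (Real.pi * S)) ^ k := by positivity
      calc (b / k) ^ k * (k / (Real.pi * S)) ^ k * (Real.exp b)⁻¹
          ≤ Real.exp b * (k / (Real.pi * S)) ^ k * (Real.exp b)⁻¹ := by gcongr
        _ = (k / (Real.pi * S)) ^ k := by field_simp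
  refine Integrable.of_bound (C := M) (by fun_prop) ?_
  filter_upwards [hae] with τ hτ using hM τ hτ

lemma ofReal_mix (q : ℕ) (a s S : ℝ) (hs : 0 < s) (hS : 0 ≤ S) (hq : q = 0 ∨ 0 < S)
    (H : Measure ℝ) [IsProbabilityMeasure H] (hH : H (Ioi (0 : ℝ))ᶜ = 0) :
    ENNReal.ofReal ((∫ τ, (τ / (2 * Real.pi * s ^ 2)) ^ ((q : ℝ) / 2) *
      Real.exp (-τ * S / (2 * s ^ 2)) ∂H) * s ^ (-(2 * a + 1))) =
    ∫⁻ τ in Ioi (0 : ℝ), ENNReal.ofReal (gbKer q a τ s S) ∂H := by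
  have hae : ∀ᵐ τ ∂H, τ ∈ Ioi (0 : ℝ) := by
    rw [ae_iff]; exact hH
  rw [Measure.restrict_eq_self_of_ae_mem hae, ← integral_mul_const,
    ofReal_integral_eq_lintegral_ofReal]
  · rfl
  · exact (gauss_integrable q s S hs hS hq H hH).mul_const _
  · filter_upwards [hae] with τ hτ
    have hτ' : 0 < τ := hτ
    simp only [Pi.zero_apply]
    positivity

lemma lintegral_swap4 {S A B C : Type*} [MeasurableSpace S] [MeasurableSpace A]
    [MeasurableSpace B] [MeasurableSpace C] (μ : Measure S) (α : Measure A) (β : Measure B)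
    (γ : Measure C) [SFinite μ] [SFinite α] [SFinite β] [SFinite γ]
    (F : S → A → B → C → ℝ≥0∞)
    (hF : Measurable fun x : S × A × B × C => F x.1 x.2.1 x.2.2.1 x.2.2.2) :
    ∫⁻ s, ∫⁻ a, ∫⁻ b, ∫⁻ c, F s a b c ∂γ ∂β ∂α ∂μ =
      ∫⁻ a, ∫⁻ b, ∫⁻ c, ∫⁻ s, F s a b c ∂μ ∂γ ∂β ∂α := by
  have h3 : Measurable fun x : S × A × B => ∫⁻ c, F x.1 x.2.1 x.2.2 c ∂γ := by
    refine Measurable.lintegral_prod_right' (f := fun x : (S × A × B) × C =>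
      F x.1.1 x.1.2.1 x.1.2.2 x.2) ?_
    exact hF.comp (by fun_prop : Measurable fun x : (S × A × B) × C =>
      (x.1.1, x.1.2.1, x.1.2.2, x.2))
  have h2 : Measurable fun x : S × A => ∫⁻ b, ∫⁻ c, F x.1 x.2 b c ∂γ ∂β := by
    refine Measurable.lintegral_prod_right' (f := fun x : (S × A) × B =>
      ∫⁻ c, F x.1.1 x.1.2 x.2 c ∂γ) ?_
    exact h3.comp (by fun_prop : Measurable fun x : (S × A) × B => (x.1.1, x.1.2, x.2))
  rw [lintegral_lintegral_swap h2.aemeasurable]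
  refine lintegral_congr fun a => ?_
  rw [lintegral_lintegral_swap]
  swap
  · exact (h3.comp (by fun_prop : Measurable fun x : S × B => (x.1, a, x.2))).aemeasurable
  refine lintegral_congr fun b => ?_
  rw [lintegral_lintegral_swap]
  exact (hF.comp (by fun_prop : Measurable fun x : S × C => (x.1, a, b, x.2))).aemeasurable

lemma lintegral_const_mul3 {A B C : Type*} [MeasurableSpace A]
    [MeasurableSpace B] [MeasurableSpace C] (α : Measure A) (β : Measure B)
    (γ : Measure C) [SFinite α] [SFinite β] [SFinite γ] (c : ℝ≥0∞)
    (N : A → B → C → ℝ≥0∞)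
    (hN : Measurable fun x : A × B × C => N x.1 x.2.1 x.2.2) :
    ∫⁻ a, ∫⁻ b, ∫⁻ z, c * N a b z ∂γ ∂β ∂α = c * ∫⁻ a, ∫⁻ b, ∫⁻ z, N a b z ∂γ ∂β ∂α := by
  have h2 : Measurable fun x : A × B => ∫⁻ z, N x.1 x.2 z ∂γ := by
    refine Measurable.lintegral_prod_right' (f := fun x : (A × B) × C => N x.1.1 x.1.2 x.2) ?_
    exact hN.comp (by fun_prop : Measurable fun x : (A × B) × C => (x.1.1, x.1.2, x.2))
  have h1 : Measurable fun a => ∫⁻ b, ∫⁻ z, N a b z ∂γ ∂β :=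
    Measurable.lintegral_prod_right' (f := fun x : A × B => ∫⁻ z, N x.1 x.2 z ∂γ) h2
  rw [← lintegral_const_mul _ h1]
  refine lintegral_congr fun a => ?_
  have h2s : Measurable fun b => ∫⁻ z, N a b z ∂γ :=
    h2.comp (by fun_prop : Measurable fun b : B => (a, b))
  rw [← lintegral_const_mul _ h2s]
  refine lintegral_congr fun b => ?_
  have hNs : Measurable fun z => N a b z :=
    hN.comp (by fun_prop : Measurable fun z : C => (a, b, z))
  rw [← lintegral_const_mul _ hNs]

/-- The part of the integrand that involves neither the scales nor the mixing variables. -/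
noncomputable def likPart {n p r : ℕ} {qs : Fin r → ℕ}
    (X : Matrix (Fin n) (Fin p) ℝ) (Z : Matrix (Fin n) ((i : Fin r) × Fin (qs i)) ℝ)
    (a0 : ℝ) (y : Fin n → ℝ) (σ0 : ℝ) (β : Fin p → ℝ)
    (u : ((i : Fin r) × Fin (qs i)) → ℝ) : ℝ :=
  (2 * Real.pi * σ0 ^ 2) ^ (-(n : ℝ) / 2) *
    Real.exp (-(∑ j, (y j - (X.mulVec β + Z.mulVec u) j) ^ 2) / (2 * σ0 ^ 2)) *
    σ0 ^ (-(2 * a0 + 1))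

lemma likPart_measurable {n p r : ℕ} {qs : Fin r → ℕ}
    (X : Matrix (Fin n) (Fin p) ℝ) (Z : Matrix (Fin n) ((i : Fin r) × Fin (qs i)) ℝ)
    (a0 : ℝ) (y : Fin n → ℝ) :
    Measurable fun x : ℝ × (Fin p → ℝ) × (((i : Fin r) × Fin (qs i)) → ℝ) =>
      ENNReal.ofReal (likPart X Z a0 y x.1 x.2.1 x.2.2) := by
  unfold likPart
  simp only [Pi.add_apply, Matrix.mulVec, dotProduct]
  fun_prop

lemma likPart_nonneg {n p r : ℕ} {qs : Fin r → ℕ}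
    (X : Matrix (Fin n) (Fin p) ℝ) (Z : Matrix (Fin n) ((i : Fin r) × Fin (qs i)) ℝ)
    (a0 : ℝ) (y : Fin n → ℝ) (σ0 : ℝ) (hσ : 0 < σ0) (β : Fin p → ℝ)
    (u : ((i : Fin r) × Fin (qs i)) → ℝ) : 0 ≤ likPart X Z a0 y σ0 β u := by
  unfold likPart
  positivity

/-- Tonelli: integrate out the scales blockwise. -/
lemma swap_scales {n p r : ℕ} {qs : Fin r → ℕ}
    (X : Matrix (Fin n) (Fin p) ℝ) (Z : Matrix (Fin n) ((i : Fin r) × Fin (qs i)) ℝ)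
    (a0 : ℝ) (y : Fin n → ℝ) (f : Fin r → ℝ → ℝ → ℝ≥0∞)
    (hf : ∀ i, Measurable fun x : ℝ × ℝ => f i x.1 x.2) :
    ∫⁻ σ in {s : Fin r → ℝ | ∀ i, 0 < s i}, ∫⁻ σ0 in Set.Ioi (0 : ℝ), ∫⁻ β : Fin p → ℝ,
      ∫⁻ u : ((i : Fin r) × Fin (qs i)) → ℝ,
        ENNReal.ofReal (likPart X Z a0 y σ0 β u) * ∏ i, f i (σ i) (∑ k, (u ⟨i, k⟩) ^ 2) =
    ∫⁻ σ0 in Set.Ioi (0 : ℝ), ∫⁻ β : Fin p → ℝ,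
      ∫⁻ u : ((i : Fin r) × Fin (qs i)) → ℝ,
        ENNReal.ofReal (likPart X Z a0 y σ0 β u) *
          ∏ i, ∫⁻ s in Ioi (0 : ℝ), f i s (∑ k, (u ⟨i, k⟩) ^ 2) := by
  have hset : {s : Fin r → ℝ | ∀ i, 0 < s i} = Set.univ.pi fun _ => Ioi (0 : ℝ) := by
    ext s; simp
  have hsec : ∀ i (S : ℝ), Measurable fun s => f i s S := fun i S =>
    (hf i).comp (measurable_id.prodMk measurable_const)
  rw [lintegral_swap4]
  · refine lintegral_congr fun σ0 => lintegral_congr fun β => lintegral_congr fun u => ?_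
    rw [lintegral_const_mul', hset, volume_pi, Measure.restrict_pi_pi]
    · rw [lintegral_pi_prod (fun _ => volume.restrict (Ioi (0 : ℝ)))
        (fun i s => f i s (∑ k, (u ⟨i, k⟩) ^ 2)) (fun i => hsec i _)]
    · exact ENNReal.ofReal_ne_top
  · refine Measurable.mul ((likPart_measurable X Z a0 y).comp measurable_snd) ?_
    refine Finset.measurable_prod _ fun i _ => ?_
    exact (hf i).comp (by fun_prop : Measurable fun x : (Fin r → ℝ) × ℝ × (Fin p → ℝ) ×
      (((i : Fin r) × Fin (qs i)) → ℝ) => (x.1 i, ∑ k, (x.2.2.2 ⟨i, k⟩) ^ 2))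

lemma normal_eq {n p r : ℕ} {qs : Fin r → ℕ}
    (X : Matrix (Fin n) (Fin p) ℝ) (Z : Matrix (Fin n) ((i : Fin r) × Fin (qs i)) ℝ)
    (a0 : ℝ) (av : Fin r → ℝ) (y : Fin n → ℝ) :
    normalMarginalSMN X Z a0 av y =
    ∫⁻ σ0 in Set.Ioi (0 : ℝ), ∫⁻ β : Fin p → ℝ,
      ∫⁻ u : ((i : Fin r) × Fin (qs i)) → ℝ,
        ENNReal.ofReal (likPart X Z a0 y σ0 β u) *
          ∏ i, ∫⁻ s in Ioi (0 : ℝ),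
            ENNReal.ofReal (gbKer (qs i) (av i) 1 s (∑ k, (u ⟨i, k⟩) ^ 2)) := by
  rw [← swap_scales X Z a0 y
    (fun i s S => ENNReal.ofReal (gbKer (qs i) (av i) 1 s S)) (fun i =>
      ((gbKer_measurable (qs i) (av i)).comp
        (measurable_const.prodMk measurable_id)).ennreal_ofReal)]
  unfold normalMarginalSMN
  have hms : MeasurableSet {s : Fin r → ℝ | ∀ i, 0 < s i} := by
    have hset : {s : Fin r → ℝ | ∀ i, 0 < s i} = Set.univ.pi fun _ => Ioi (0 : ℝ) := by
      ext s; simp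
    rw [hset]; exact MeasurableSet.univ_pi fun _ => measurableSet_Ioi
  refine setLIntegral_congr_fun hms fun σ hσ => ?_
  refine setLIntegral_congr_fun measurableSet_Ioi fun σ0 hσ0 => ?_
  refine lintegral_congr fun β => lintegral_congr fun u => ?_
  have hσ' : ∀ i, 0 < σ i := hσ
  rw [← ENNReal.ofReal_prod_of_nonneg, ← ENNReal.ofReal_mul (likPart_nonneg X Z a0 y σ0 hσ0 β u)]
  · congr 1
    have hblock : ∏ ik : (i : Fin r) × Fin (qs i), ((2 * Real.pi * (σ ik.1) ^ 2) ^ (-(1 : ℝ) / 2) *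
                  Real.exp (-(u ik) ^ 2 / (2 * (σ ik.1) ^ 2))) =
        ∏ i, ((1 / (2 * Real.pi * σ i ^ 2)) ^ ((qs i : ℝ) / 2) *
          Real.exp (-1 * (∑ k, (u ⟨i, k⟩) ^ 2) / (2 * σ i ^ 2))) := by
      rw [Fintype.prod_sigma]
      refine Finset.prod_congr rfl fun i _ => ?_
      have hi := hσ' i
      dsimp only
      rw [Finset.prod_mul_distrib, Finset.prod_const, ← Real.exp_sum, Finset.card_univ,
        Fintype.card_fin]
      congr 1
      · rw [← Real.rpow_natCast, ← Real.rpow_mul (by positivity), one_div,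
          Real.inv_rpow (by positivity), ← Real.rpow_neg (by positivity)]
        congr 1
        ring
      · congr 1
        rw [← Finset.sum_div, neg_one_mul, Finset.sum_neg_distrib]
    rw [hblock]
    simp only [gbKer, likPart]
    rw [Finset.prod_mul_distrib (g := fun i => σ i ^ (-(2 * av i + 1)))]
    ring
  · intro i _
    have hi := hσ' i
    unfold gbKer
    positivity

lemma smn_inner_s9 {n p r : ℕ} {qs : Fin r → ℕ}
    (X : Matrix (Fin n) (Fin p) ℝ) (Z : Matrix (Fin n) ((i : Fin r) × Fin (qs i)) ℝ)
    (a0 : ℝ) (av : Fin r → ℝ) (y : Fin n → ℝ) (w : ℝ) (hw : 0 ≤ w)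
    (H : Measure ℝ) [IsProbabilityMeasure H] (hH : H (Ioi (0 : ℝ))ᶜ = 0) :
    ∫⁻ σ in {s : Fin r → ℝ | ∀ i, 0 < s i},
      ∫⁻ σ0 in Set.Ioi (0 : ℝ),
        ∫⁻ β : Fin p → ℝ,
          ∫⁻ u : ((i : Fin r) × Fin (qs i)) → ℝ,
            ENNReal.ofReal (
              (2 * Real.pi * σ0 ^ 2) ^ (-(n : ℝ) / 2) *
                Real.exp (-(∑ j, (y j - (X.mulVec β + Z.mulVec u) j) ^ 2) / (2 * σ0 ^ 2)) *
                (∏ i, ∫ τ, (τ / (2 * Real.pi * (σ i) ^ 2)) ^ ((qs i : ℝ) / 2) *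
                    Real.exp (-τ * (∑ k, (u ⟨i, k⟩) ^ 2) / (2 * (σ i) ^ 2)) ∂H) *
                σ0 ^ (-(2 * a0 + 1)) * (∏ i, (σ i) ^ (-(2 * av i + 1))) * w) =
    ((∏ i, ∫⁻ τ in Set.Ioi (0 : ℝ), ENNReal.ofReal (τ ^ (-(av i))) ∂H) * ENNReal.ofReal w) *
      normalMarginalSMN X Z a0 av y := by
  have hms : MeasurableSet {s : Fin r → ℝ | ∀ i, 0 < s i} := by
    have hset : {s : Fin r → ℝ | ∀ i, 0 < s i} = Set.univ.pi fun _ => Ioi (0 : ℝ) := by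
      ext s; simp
    rw [hset]; exact MeasurableSet.univ_pi fun _ => measurableSet_Ioi
  have hu : ∀ᵐ u : ((i : Fin r) × Fin (qs i)) → ℝ, ∀ ik, u ik ≠ 0 := by
    rw [ae_all_iff]
    intro ik
    exact Measure.ae_eval_ne (α := fun _ => ℝ) (fun _ => volume) ik (0 : ℝ)
  have hfm : ∀ i, Measurable fun x : ℝ × ℝ =>
      ∫⁻ τ in Ioi (0 : ℝ), ENNReal.ofReal (gbKer (qs i) (av i) τ x.1 x.2) ∂H := fun i => by
    refine Measurable.lintegral_prod_right' (f := fun z : (ℝ × ℝ) × ℝ =>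
      ENNReal.ofReal (gbKer (qs i) (av i) z.2 z.1.1 z.1.2)) ?_
    exact ((gbKer_measurable (qs i) (av i)).comp (by fun_prop : Measurable
      fun z : (ℝ × ℝ) × ℝ => (z.2, z.1.1, z.1.2))).ennreal_ofReal
  have hnm : ∀ i, Measurable fun S : ℝ =>
      ∫⁻ s in Ioi (0 : ℝ), ENNReal.ofReal (gbKer (qs i) (av i) 1 s S) := fun i => by
    refine Measurable.lintegral_prod_right' (f := fun z : ℝ × ℝ =>
      ENNReal.ofReal (gbKer (qs i) (av i) 1 z.2 z.1)) ?_
    exact ((gbKer_measurable (qs i) (av i)).comp (by fun_prop : Measurable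
      fun z : ℝ × ℝ => ((1 : ℝ), z.2, z.1))).ennreal_ofReal
  set c : ℝ≥0∞ := ∏ i, ∫⁻ τ in Set.Ioi (0 : ℝ), ENNReal.ofReal (τ ^ (-(av i))) ∂H with hc
  have hstep : ∀ σ ∈ {s : Fin r → ℝ | ∀ i, 0 < s i}, ∀ σ0 ∈ Ioi (0 : ℝ), ∀ β : Fin p → ℝ,
      ∫⁻ u : ((i : Fin r) × Fin (qs i)) → ℝ,
            ENNReal.ofReal (
              (2 * Real.pi * σ0 ^ 2) ^ (-(n : ℝ) / 2) *
                Real.exp (-(∑ j, (y j - (X.mulVec β + Z.mulVec u) j) ^ 2) / (2 * σ0 ^ 2)) *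
                (∏ i, ∫ τ, (τ / (2 * Real.pi * (σ i) ^ 2)) ^ ((qs i : ℝ) / 2) *
                    Real.exp (-τ * (∑ k, (u ⟨i, k⟩) ^ 2) / (2 * (σ i) ^ 2)) ∂H) *
                σ0 ^ (-(2 * a0 + 1)) * (∏ i, (σ i) ^ (-(2 * av i + 1))) * w) =
      ∫⁻ u : ((i : Fin r) × Fin (qs i)) → ℝ,
        ENNReal.ofReal w * (ENNReal.ofReal (likPart X Z a0 y σ0 β u) *
          ∏ i, ∫⁻ τ in Ioi (0 : ℝ), ENNReal.ofReal (gbKer (qs i) (av i) τ (σ i)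
            (∑ k, (u ⟨i, k⟩) ^ 2)) ∂H) := by
    intro σ hσ σ0 hσ0 β
    have hσ' : ∀ i, 0 < σ i := hσ
    refine lintegral_congr_ae ?_
    filter_upwards [hu] with u hu
    have hae : ∀ᵐ τ ∂H, τ ∈ Ioi (0 : ℝ) := by
      rw [ae_iff]; exact hH
    have hb : ∀ i, ∫⁻ τ in Ioi (0 : ℝ), ENNReal.ofReal (gbKer (qs i) (av i) τ (σ i)
            (∑ k, (u ⟨i, k⟩) ^ 2)) ∂H = _ := fun i =>
      (ofReal_mix (qs i) (av i) (σ i) (∑ k, (u ⟨i, k⟩) ^ 2) (hσ' i)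
        (Finset.sum_nonneg fun k _ => sq_nonneg _) (by
          rcases Nat.eq_zero_or_pos (qs i) with h | h
          · exact Or.inl h
          · right
            have : Nonempty (Fin (qs i)) := ⟨⟨0, h⟩⟩
            exact Finset.sum_pos (fun k _ => by have := hu ⟨i, k⟩; positivity)
              Finset.univ_nonempty) H hH).symm
    simp_rw [hb]
    rw [← ENNReal.ofReal_prod_of_nonneg,
      ← ENNReal.ofReal_mul (likPart_nonneg X Z a0 y σ0 hσ0 β u), ← ENNReal.ofReal_mul hw]
    · congr 1
      rw [Finset.prod_mul_distrib]
      simp only [likPart]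
      ring
    · intro i _
      have hi := hσ' i
      refine mul_nonneg (integral_nonneg_of_ae ?_) (by positivity)
      filter_upwards [hae] with τ hτ
      have hτ' : 0 < τ := hτ
      simp only [Pi.zero_apply]
      positivity
  have e1 : ∀ (ρ : ℝ≥0∞), ρ ≠ ⊤ → ∀ G : (Fin r → ℝ) → ℝ → (Fin p → ℝ) →
      (((i : Fin r) × Fin (qs i)) → ℝ) → ℝ≥0∞,
      ∫⁻ σ in {s : Fin r → ℝ | ∀ i, 0 < s i}, ∫⁻ σ0 in Set.Ioi (0 : ℝ), ∫⁻ β : Fin p → ℝ,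
      ∫⁻ u : ((i : Fin r) × Fin (qs i)) → ℝ, ρ * G σ σ0 β u =
      ρ * ∫⁻ σ in {s : Fin r → ℝ | ∀ i, 0 < s i}, ∫⁻ σ0 in Set.Ioi (0 : ℝ), ∫⁻ β : Fin p → ℝ,
      ∫⁻ u : ((i : Fin r) × Fin (qs i)) → ℝ, G σ σ0 β u := by
    intro ρ hρ G
    simp_rw [lintegral_const_mul' ρ _ hρ]
  rw [setLIntegral_congr_fun hms fun σ hσ => setLIntegral_congr_fun measurableSet_Ioi
    fun σ0 hσ0 => lintegral_congr fun β => hstep σ hσ σ0 hσ0 β,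
    e1 _ ENNReal.ofReal_ne_top (fun σ σ0 β u => ENNReal.ofReal (likPart X Z a0 y σ0 β u) *
          ∏ i, ∫⁻ τ in Ioi (0 : ℝ), ENNReal.ofReal (gbKer (qs i) (av i) τ (σ i)
            (∑ k, (u ⟨i, k⟩) ^ 2)) ∂H),
    swap_scales X Z a0 y (fun i s S => ∫⁻ τ in Ioi (0 : ℝ),
      ENNReal.ofReal (gbKer (qs i) (av i) τ s S) ∂H) hfm, mul_comm c, mul_assoc, normal_eq]
  congr 1
  -- the last step pulls the constant out of three measurable integrals
  set N : ℝ → (Fin p → ℝ) → (((i : Fin r) × Fin (qs i)) → ℝ) → ℝ≥0∞ := fun σ0 β u =>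
    ENNReal.ofReal (likPart X Z a0 y σ0 β u) *
          ∏ i, ∫⁻ s in Ioi (0 : ℝ),
            ENNReal.ofReal (gbKer (qs i) (av i) 1 s (∑ k, (u ⟨i, k⟩) ^ 2)) with hN
  have hNm : Measurable fun x : ℝ × (Fin p → ℝ) × (((i : Fin r) × Fin (qs i)) → ℝ) =>
      N x.1 x.2.1 x.2.2 := by
    refine (likPart_measurable X Z a0 y).mul (Finset.measurable_prod _ fun i _ => ?_)
    exact (hnm i).comp (by fun_prop : Measurable fun x : ℝ × (Fin p → ℝ) ×
      (((i : Fin r) × Fin (qs i)) → ℝ) => ∑ k, (x.2.2 ⟨i, k⟩) ^ 2)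
  rw [← lintegral_const_mul3 _ _ _ c N hNm]
  refine lintegral_congr fun σ0 => lintegral_congr fun β => lintegral_congr fun u => ?_
  simp_rw [mix_lintegral]
  rw [Finset.prod_mul_distrib, ← hc]
  simp only [hN]
  ring

lemma smn_eq {n p r : ℕ} {qs : Fin r → ℕ}
    (X : Matrix (Fin n) (Fin p) ℝ) (Z : Matrix (Fin n) ((i : Fin r) × Fin (qs i)) ℝ)
    (Hmix : ℝ → Measure ℝ) (Δset : Set ℝ) (πδ : ℝ → ℝ)
    (a0 : ℝ) (av : Fin r → ℝ) (hΔmeas : MeasurableSet Δset)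
    (hHprob : ∀ δ ∈ Δset, IsProbabilityMeasure (Hmix δ))
    (hHsupp : ∀ δ ∈ Δset, Hmix δ (Set.Ioi (0 : ℝ))ᶜ = 0)
    (hπnonneg : ∀ δ ∈ Δset, 0 ≤ πδ δ) (y : Fin n → ℝ)
    (hmNfin : normalMarginalSMN X Z a0 av y < ⊤) :
    smnMarginal X Z Hmix Δset πδ a0 av y = (∫⁻ δ in Δset,
      (∏ i, ∫⁻ τ in Set.Ioi (0 : ℝ), ENNReal.ofReal (τ ^ (-(av i))) ∂(Hmix δ)) *
        ENNReal.ofReal (πδ δ)) * normalMarginalSMN X Z a0 av y := by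
  rw [← lintegral_mul_const' _ _ hmNfin.ne]
  unfold smnMarginal
  refine setLIntegral_congr_fun hΔmeas fun δ hδ => ?_
  have := hHprob δ hδ
  exact smn_inner_s9 X Z a0 av y (πδ δ) (hπnonneg δ hδ) (Hmix δ) (hHsupp δ hδ)

/-- The Bayes factor between two scale-mixture-of-normals specifications of
the random effects of the linear mixed model equals `C₁ / C₂`, where
`C_j = ∫_Δ [∏ᵢ ∫₀^∞ τᵢ^{-aᵢ} dH_j(τᵢ|δ)] π_j(δ) dδ`; in particular it does not depend on the
data `y`. -/
theorem smn_bayes_factor_independent_of_data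
    {n p r : ℕ} {qs : Fin r → ℕ}
    (X : Matrix (Fin n) (Fin p) ℝ) (Z : Matrix (Fin n) ((i : Fin r) × Fin (qs i)) ℝ)
    (Hmix1 Hmix2 : ℝ → Measure ℝ) (Δset : Set ℝ) (πδ1 πδ2 : ℝ → ℝ)
    (a0 : ℝ) (av : Fin r → ℝ)
    (hnp : p < n) (hX : X.rank = p)
    (hΔmeas : MeasurableSet Δset)
    (hHmeas1 : Measurable Hmix1) (hHmeas2 : Measurable Hmix2)
    -- the mixing (probability) distributions are supported on (0,∞)
    (hHprob1 : ∀ δ ∈ Δset, IsProbabilityMeasure (Hmix1 δ))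
    (hHsupp1 : ∀ δ ∈ Δset, Hmix1 δ (Set.Ioi (0 : ℝ))ᶜ = 0)
    (hHprob2 : ∀ δ ∈ Δset, IsProbabilityMeasure (Hmix2 δ))
    (hHsupp2 : ∀ δ ∈ Δset, Hmix2 δ (Set.Ioi (0 : ℝ))ᶜ = 0)
    -- proper prior densities on `Δset`
    (hπmeas1 : Measurable πδ1) (hπmeas2 : Measurable πδ2)
    (hπnonneg1 : ∀ δ ∈ Δset, 0 ≤ πδ1 δ)
    (hπproper1 : ∫ δ in Δset, πδ1 δ = 1)
    (hπnonneg2 : ∀ δ ∈ Δset, 0 ≤ πδ2 δ)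
    (hπproper2 : ∫ δ in Δset, πδ2 δ = 1)
    -- the constants C₁ and C₂ are finite and positive
    (C1 C2 : ℝ≥0∞)
    (hC1 : C1 = ∫⁻ δ in Δset,
      (∏ i, ∫⁻ τ in Set.Ioi (0 : ℝ), ENNReal.ofReal (τ ^ (-(av i))) ∂(Hmix1 δ)) *
        ENNReal.ofReal (πδ1 δ))
    (hC2 : C2 = ∫⁻ δ in Δset,
      (∏ i, ∫⁻ τ in Set.Ioi (0 : ℝ), ENNReal.ofReal (τ ^ (-(av i))) ∂(Hmix2 δ)) *
        ENNReal.ofReal (πδ2 δ))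
    (hC1pos : 0 < C1) (hC1fin : C1 < ⊤)
    (hC2pos : 0 < C2) (hC2fin : C2 < ⊤)
    -- an observation whose normal-random-effects marginal likelihood is positive and finite
    (y : Fin n → ℝ)
    (hmNpos : 0 < normalMarginalSMN X Z a0 av y)
    (hmNfin : normalMarginalSMN X Z a0 av y < ⊤) :
    smnMarginal X Z Hmix1 Δset πδ1 a0 av y / smnMarginal X Z Hmix2 Δset πδ2 a0 av y =
      C1 / C2 := by

  rw [smn_eq X Z Hmix1 Δset πδ1 a0 av hΔmeas hHprob1 hHsupp1 hπnonneg1 y hmNfin,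
    smn_eq X Z Hmix2 Δset πδ2 a0 av hΔmeas hHprob2 hHsupp2 hπnonneg2 y hmNfin, ← hC1, ← hC2]
  exact ENNReal.mul_div_mul_right _ _ hmNpos.ne' hmNfin.ne
end
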